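/- (E,F) is a resistance form on V_*: (i) {u ∈ F : E(u,u) = 0} is exactly the set of constant functions on V_*; (ii) the quotient of F by the constants, equipped with E, is a Hilbert space; (iii) for every nonempty finite subset V of V_*, every function in ℝ^V is the restriction to V of some u ∈ F; (iv) R_E(x,y) < ∞ for all x,y ∈ V_*; (v) for every u ∈ F, the function min(max(u,0),1) belongs to F and E(min(max(u,0),1), min(max(u,0),1)) ≤ E(u,u). Moreover R_E is a metric on V_*, and |u(x)−u(y)|² ≤ R_E(x,y)·E(u,u) for every u ∈ F and x,y ∈ V_*. -/

import Mathlib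

open scoped BigOperators ENNReal
open Set Filter MeasureTheory

noncomputable section

abbrev E2 : Type := EuclideanSpace ℝ (Fin 2)

/-- The index set `S_l` of the level-`l` thin Sierpinski gasket. -/
def Sset (l : ℕ) : Set (ℕ × ℕ) :=
  {p | p.1 + p.2 ≤ l - 1 ∧ p.1 * p.2 * (l - 1 - p.1 - p.2) = 0}

/-- The contraction `f^l_i`. -/
def fmap (q : Fin 3 → E2) (l : ℕ) (i : ℕ × ℕ) (x : E2) : E2 :=
  q 0 + ((i.1 : ℝ) / l) • (q 1 - q 0) + ((i.2 : ℝ) / l) • (q 2 - q 0)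
    + (l : ℝ)⁻¹ • (x - q 0)

/-- The closed equilateral triangle `△`. -/
def Tri (q : Fin 3 → E2) : Set E2 := convexHull ℝ (Set.range q)

def V0 (q : Fin 3 → E2) : Set E2 := Set.range q

/-- Words of length `n` (padded by `(0,0)` beyond position `n`). -/
def Wn (l : ℕ → ℕ) (n : ℕ) : Set (ℕ → ℕ × ℕ) :=
  {w | (∀ k, k < n → w k ∈ Sset (l k)) ∧ ∀ k, n ≤ k → w k = (0, 0)}

/-- `wordMap q l w n = f^{l_1}_{w_1} ∘ ⋯ ∘ f^{l_n}_{w_n}` (0-indexed). -/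
def wordMap (q : Fin 3 → E2) (l : ℕ → ℕ) (w : ℕ → ℕ × ℕ) : ℕ → E2 → E2
  | 0 => id
  | n + 1 => wordMap q l w n ∘ fmap q (l n) (w n)

/-- The thin scale irregular Sierpinski gasket `K`. -/
def Gasket (q : Fin 3 → E2) (l : ℕ → ℕ) : Set E2 :=
  ⋂ n, ⋃ w ∈ Wn l n, wordMap q l w n '' Tri q

/-- The cell `K_w = K ∩ f_w(△)`. -/
def Cell (q : Fin 3 → E2) (l : ℕ → ℕ) (n : ℕ) (w : ℕ → ℕ × ℕ) : Set E2 :=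
  Gasket q l ∩ wordMap q l w n '' Tri q

def Vn (q : Fin 3 → E2) (l : ℕ → ℕ) (n : ℕ) : Set E2 :=
  ⋃ w ∈ Wn l n, wordMap q l w n '' V0 q

def Vstar (q : Fin 3 → E2) (l : ℕ → ℕ) : Set E2 := ⋃ n, Vn q l n

def Ln (l : ℕ → ℕ) (n : ℕ) : ℕ := ∏ k ∈ Finset.range n, l k

def Mn (l : ℕ → ℕ) (n : ℕ) : ℕ := ∏ k ∈ Finset.range n, (3 * l k - 3)

def rl (l : ℕ) : ℝ := (2 * (l : ℝ) / 3 + 1 / 9)⁻¹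

def Rn (l : ℕ → ℕ) (n : ℕ) : ℝ := ∏ k ∈ Finset.range n, rl (l k)

def Tn (l : ℕ → ℕ) (n : ℕ) : ℝ := (Mn l n : ℝ) / Rn l n

/-- The basic energy form `E⁰` on `ℝ^{V₀}`. -/
def E0 (q : Fin 3 → E2) (u v : E2 → ℝ) : ℝ :=
  (1 / 2) * ∑ j : Fin 3, ∑ k : Fin 3, (u (q j) - u (q k)) * (v (q j) - v (q k))

/-- The level-`n` energy form `Eⁿ`. -/
def En (q : Fin 3 → E2) (l : ℕ → ℕ) (n : ℕ) (u v : E2 → ℝ) : ℝ :=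
  (Rn l n)⁻¹ * ∑ᶠ w ∈ Wn l n, E0 q (u ∘ wordMap q l w n) (v ∘ wordMap q l w n)

/-- The domain `F` of the limit resistance form. -/
def FDom (q : Fin 3 → E2) (l : ℕ → ℕ) : Set (E2 → ℝ) :=
  {u | ∃ C : ℝ, ∀ n, En q l n u u ≤ C}

/-- The limit form `E(u,v) = lim_n Eⁿ(u,v)`. -/
def EForm (q : Fin 3 → E2) (l : ℕ → ℕ) (u v : E2 → ℝ) : ℝ :=
  limUnder atTop fun n => En q l n u v

/-- The intrinsic (geodesic) distance on `K`, with values in `ℝ≥0∞`. -/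
def pdist (q : Fin 3 → E2) (l : ℕ → ℕ) (x y : E2) : ℝ≥0∞ :=
  ⨅ (γ : ℝ → E2) (_ : ContinuousOn γ (Set.Icc 0 1))
    (_ : Set.MapsTo γ (Set.Icc 0 1) (Gasket q l)) (_ : γ 0 = x) (_ : γ 1 = y),
    eVariationOn γ (Set.Icc 0 1)

def gdist (q : Fin 3 → E2) (l : ℕ → ℕ) (x y : E2) : ℝ := (pdist q l x y).toReal

/-- The set of resistance quotients used to define `R_E`. -/
def REset (q : Fin 3 → E2) (l : ℕ → ℕ) (x y : E2) : Set ℝ :=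
  {t | ∃ u ∈ FDom q l, 0 < EForm q l u u ∧ t = (u x - u y) ^ 2 / EForm q l u u}

/-- The resistance metric `R_E`. -/
def RE (q : Fin 3 → E2) (l : ℕ → ℕ) (x y : E2) : ℝ := sSup (REset q l x y)

/-- Resistance quotients over continuous representatives (i.e. `F` viewed in `C(K)`). -/
def REcSet (q : Fin 3 → E2) (l : ℕ → ℕ) (x y : E2) : Set ℝ :=
  {t | ∃ u ∈ FDom q l, ContinuousOn u (Gasket q l) ∧ 0 < EForm q l u u ∧
    t = (u x - u y) ^ 2 / EForm q l u u}

def REc (q : Fin 3 → E2) (l : ℕ → ℕ) (x y : E2) : ℝ := sSup (REcSet q l x y)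

/-- The open `d`-ball in `K`. -/
def Bd (q : Fin 3 → E2) (l : ℕ → ℕ) (x : E2) (s : ℝ) : Set E2 :=
  {y ∈ Gasket q l | gdist q l x y < s}

/-- The open `R_E`-ball in `K`. -/
def BRc (q : Fin 3 → E2) (l : ℕ → ℕ) (x : E2) (s : ℝ) : Set E2 :=
  {y ∈ Gasket q l | REc q l x y < s}

/-- `Λ^{(k)}_{n,w}`: words within `k` cell-steps of `w`. -/
def Lam (q : Fin 3 → E2) (l : ℕ → ℕ) (n : ℕ) (w : ℕ → ℕ × ℕ) (k : ℕ) :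
    Set (ℕ → ℕ × ℕ) :=
  {v ∈ Wn l n | ∃ c : ℕ → ℕ → ℕ × ℕ, c 0 = w ∧ c k = v ∧ (∀ j ≤ k, c j ∈ Wn l n) ∧
    ∀ j < k, (Cell q l n (c j) ∩ Cell q l n (c (j + 1))).Nonempty}

/-- `U^{(k)}_{n,w}`. -/
def Unwk (q : Fin 3 → E2) (l : ℕ → ℕ) (n : ℕ) (w : ℕ → ℕ × ℕ) (k : ℕ) : Set E2 :=
  ⋃ v ∈ Lam q l n w k, Cell q l n v

def betaZero (l : ℕ → ℕ) : ℝ :=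
  ⨅ n : ℕ, Real.logb (l n) (2 * (l n : ℝ) ^ 2 - (5 / 3) * (l n : ℝ) - 1 / 3)

def betaOne (l : ℕ → ℕ) : ℝ :=
  ⨆ n : ℕ, Real.logb (l n) (2 * (l n : ℝ) ^ 2 - (5 / 3) * (l n : ℝ) - 1 / 3)

def betaM (l : ℕ → ℕ) : ℝ := ⨅ n : ℕ, Real.logb (l n) (3 * (l n : ℝ) - 3)

def betaR (l : ℕ → ℕ) : ℝ := ⨆ n : ℕ, Real.logb (l n) ((rl (l n))⁻¹)

/-- The value of `Ψ` on the interval `[1/L_{n+1}, 1/L_n]`. -/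
def psiPiece (l : ℕ → ℕ) (n : ℕ) (s : ℝ) : ℝ :=
  (Tn l (n + 1))⁻¹
    * (1 + ((3 * (l n : ℝ) - 4) / ((l n : ℝ) - 1)) * ((Ln l (n + 1) : ℝ) * s - 1))
    * (1 + (((2 / 3) * (l n : ℝ) - 8 / 9) / ((l n : ℝ) - 1)) * ((Ln l (n + 1) : ℝ) * s - 1))

/-- `Ψ = Ψ_𝒍` is characterized by these defining clauses. -/
def IsPsi (l : ℕ → ℕ) (Psi : ℝ → ℝ) : Prop :=
  (∀ n : ℕ, ∀ s : ℝ, ((Ln l (n + 1) : ℝ))⁻¹ ≤ s → s ≤ ((Ln l n : ℝ))⁻¹ →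
      Psi s = psiPiece l n s) ∧
  (∀ s : ℝ, 1 ≤ s → Psi s = s ^ betaZero l) ∧ Psi 0 = 0

def psiMPiece (l : ℕ → ℕ) (n : ℕ) (s : ℝ) : ℝ :=
  ((Mn l (n + 1) : ℝ))⁻¹
    * (1 + ((3 * (l n : ℝ) - 4) / ((l n : ℝ) - 1)) * ((Ln l (n + 1) : ℝ) * s - 1))

def IsPsiM (l : ℕ → ℕ) (PsiM : ℝ → ℝ) : Prop :=
  (∀ n : ℕ, ∀ s : ℝ, ((Ln l (n + 1) : ℝ))⁻¹ ≤ s → s ≤ ((Ln l n : ℝ))⁻¹ →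
      PsiM s = psiMPiece l n s) ∧
  (∀ s : ℝ, 1 ≤ s → PsiM s = s ^ betaM l) ∧ PsiM 0 = 0

def psiRPiece (l : ℕ → ℕ) (n : ℕ) (s : ℝ) : ℝ :=
  Rn l (n + 1)
    * (1 + (((2 / 3) * (l n : ℝ) - 8 / 9) / ((l n : ℝ) - 1)) * ((Ln l (n + 1) : ℝ) * s - 1))

def IsPsiR (l : ℕ → ℕ) (PsiR : ℝ → ℝ) : Prop :=
  (∀ n : ℕ, ∀ s : ℝ, ((Ln l (n + 1) : ℝ))⁻¹ ≤ s → s ≤ ((Ln l n : ℝ))⁻¹ →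
      PsiR s = psiRPiece l n s) ∧
  (∀ s : ℝ, 1 ≤ s → PsiR s = s ^ betaR l) ∧ PsiR 0 = 0

/-- `μ` is the uniform distribution on `K`: a Borel measure carried by `K`
with `μ(K_w) = 1/M_{|w|}` for every word `w`. -/
def IsUnif (q : Fin 3 → E2) (l : ℕ → ℕ) (μ : Measure E2) : Prop :=
  μ (Gasket q l)ᶜ = 0 ∧ ∀ n : ℕ, ∀ w ∈ Wn l n, μ (Cell q l n w) = ((Mn l n : ℝ≥0∞))⁻¹

/-- `μ` is the energy measure of `u`: a Borel measure carried by `K` with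
`μ(K_w) = R_{|w|}⁻¹ E^{𝒍^{|w|}}(u∘F_w, u∘F_w)` for every word `w`. -/
def IsEnergyMeasure (q : Fin 3 → E2) (l : ℕ → ℕ) (u : E2 → ℝ) (μ : Measure E2) : Prop :=
  μ (Gasket q l)ᶜ = 0 ∧ ∀ n : ℕ, ∀ w ∈ Wn l n,
    μ (Cell q l n w) = ENNReal.ofReal ((Rn l n)⁻¹ *
      EForm q (fun k => l (k + n)) (u ∘ wordMap q l w n) (u ∘ wordMap q l w n))



/-! ### The one-level harmonic extension -/

/-- Values of the harmonic function on the outer vertices of a side. -/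
def sideOut (l : ℕ) (x F G y F' G' : ℝ) (i : ℕ) : ℝ :=
  if i = 0 then x else if i = 1 then x - (5 * F + 4 * G) / 9
  else if i + 1 = l then y - (5 * F' + 4 * G') / 9
  else if i = l then y
  else x - (5 / 9) * (2 * F + G) - (2 / 3) * ((i : ℝ) - 2) * F

/-- Values of the harmonic function on the inner vertices of a side. -/
def sideIn (l : ℕ) (x F G y F' G' : ℝ) (i : ℕ) : ℝ :=
  if i = 1 then x - (2 / 3) * (F + G)
  else if i + 2 = l then y - (2 / 3) * (F' + G')
  else x - (5 / 9) * (2 * F + G) - (2 / 3) * ((i : ℝ) - 2) * F - F / 3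

/-- Harmonic function in terms of boundary values and currents. -/
def harmAux (l : ℕ) (x y z F G K : ℝ) (a b : ℕ) : ℝ :=
  if b = 0 then sideOut l x F G y (-F) K a
  else if a = 0 then sideOut l x G F z (-G) (-K) b
  else if a + b = l then sideOut l y K (-F) z (-K) (-G) b
  else if b = 1 then sideIn l x F G y (-F) K a
  else if a = 1 then sideIn l x G F z (-G) (-K) b
  else sideIn l y K (-F) z (-K) (-G) b

def harm (l : ℕ) (x y z : ℝ) (a b : ℕ) : ℝ :=
  harmAux l x y z (rl l * (x - y)) (rl l * (x - z)) (rl l * (y - z)) a b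

/-- Triangle energy. -/
def tri (x y z x' y' z' : ℝ) : ℝ :=
  (x - y) * (x' - y') + (x - z) * (x' - z') + (y - z) * (y' - z')

def cellE (h V : ℕ → ℕ → ℝ) (a b : ℕ) : ℝ :=
  tri (h a b) (h (a + 1) b) (h a (b + 1)) (V a b) (V (a + 1) b) (V a (b + 1))

/-- `S_l` as a finset. -/
def Sf (l : ℕ) : Finset (ℕ × ℕ) :=
  (Finset.range l ×ˢ Finset.range l).filter
    (fun p => p.1 + p.2 ≤ l - 1 ∧ p.1 * p.2 * (l - 1 - p.1 - p.2) = 0)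

lemma mem_Sf {l : ℕ} (hl : 5 ≤ l) (p : ℕ × ℕ) : p ∈ Sf l ↔ p ∈ Sset l := by
  simp only [Sf, Sset, Finset.mem_filter, Finset.mem_product, Finset.mem_range, Set.mem_ofPred_eq]
  constructor
  · exact fun h => h.2
  · intro h
    refine ⟨?_, h⟩
    have := h.1
    omega

lemma mem_Sset_iff {l : ℕ} (a b : ℕ) :
    (a, b) ∈ Sset l ↔ a + b ≤ l - 1 ∧ (a = 0 ∨ b = 0 ∨ a + b = l - 1) := by
  simp only [Sset, Set.mem_ofPred_eq, mul_eq_zero]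
  omega

lemma Sf_eq (m : ℕ) : Sf (m + 5) =
    (Finset.range (m + 4)).image (fun i => (i, 0)) ∪
    ((Finset.range (m + 4)).image (fun i => (m + 4 - i, i)) ∪
    (Finset.range (m + 4)).image (fun i => (0, i + 1))) := by
  ext ⟨a, b⟩
  rw [mem_Sf (by omega), mem_Sset_iff]
  simp only [Finset.mem_union, Finset.mem_image, Finset.mem_range, Prod.mk.injEq]
  constructor
  · rintro ⟨h1, h2⟩
    by_cases hb : b = 0
    · by_cases ha : a < m + 4
      · exact Or.inl ⟨a, ha, rfl, hb.symm⟩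
      · exact Or.inr (Or.inl ⟨0, by omega, by omega, by omega⟩)
    · by_cases ha : a = 0
      · exact Or.inr (Or.inr ⟨b - 1, by omega, by omega, by omega⟩)
      · exact Or.inr (Or.inl ⟨b, by omega, by omega, by omega⟩)
  · rintro (⟨i, h1, h2, h3⟩ | ⟨i, h1, h2, h3⟩ | ⟨i, h1, h2, h3⟩) <;> omega

lemma sum_Sf (m : ℕ) (φ : ℕ × ℕ → ℝ) : ∑ i ∈ Sf (m + 5), φ i =
    ∑ i ∈ Finset.range (m + 4), φ (i, 0) + (∑ i ∈ Finset.range (m + 4), φ (m + 4 - i, i) +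
      ∑ i ∈ Finset.range (m + 4), φ (0, i + 1)) := by
  rw [Sf_eq, Finset.sum_union, Finset.sum_union, Finset.sum_image, Finset.sum_image,
    Finset.sum_image]
  · intro i _ j _ h
    simp only [Prod.mk.injEq] at h
    omega
  · intro i _ j _ h
    simp only [Prod.mk.injEq] at h
    omega
  · intro i _ j _ h
    simp only [Prod.mk.injEq] at h
    omega
  · rw [Finset.disjoint_left]
    rintro ⟨a, b⟩ h1 h2
    simp only [Finset.mem_image, Finset.mem_range, Prod.mk.injEq] at h1 h2
    obtain ⟨i, h1⟩ := h1
    obtain ⟨j, h2⟩ := h2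
    omega
  · rw [Finset.disjoint_left]
    rintro ⟨a, b⟩ h1 h2
    simp only [Finset.mem_image, Finset.mem_range, Prod.mk.injEq, Finset.mem_union] at h1 h2
    obtain ⟨i, h1⟩ := h1
    obtain ⟨j, h2⟩ | ⟨j, h2⟩ := h2 <;> omega

lemma sum_arc (m : ℕ) (φ : ℕ → ℝ) : ∑ i ∈ Finset.range (m + 4), φ i =
    φ 0 + φ 1 + ∑ i ∈ Finset.range (m + 1), φ (i + 2) + φ (m + 3) := by
  rw [Finset.sum_range_succ, Finset.sum_range_succ', Finset.sum_range_succ']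
  ring

lemma sum_arc' (m : ℕ) (φ : ℕ → ℝ) : ∑ i ∈ Finset.range (m + 4), φ (i + 1) =
    φ 1 + ∑ i ∈ Finset.range (m + 1), φ (i + 2) + φ (m + 3) + φ (m + 4) := by
  rw [Finset.sum_range_succ, Finset.sum_range_succ, Finset.sum_range_succ']
  ring

lemma harmAux_key (m : ℕ) (x y z F G K : ℝ) (V : ℕ → ℕ → ℝ)
    (hy : y = x - (2 * ((m + 5 : ℕ) : ℝ) / 3 + 1 / 9) * F)
    (hz : z = x - (2 * ((m + 5 : ℕ) : ℝ) / 3 + 1 / 9) * G)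
    (hK : K = G - F) :
    ∑ i ∈ Sf (m + 5), cellE (harmAux (m + 5) x y z F G K) V i.1 i.2 =
      F * (V 0 0 - V (m + 5) 0) + G * (V 0 0 - V 0 (m + 5))
        + K * (V (m + 5) 0 - V 0 (m + 5)) := by
  rw [sum_Sf]
  simp only
  rw [sum_arc m (fun i => cellE (harmAux (m + 5) x y z F G K) V i 0),
    sum_arc m (fun i => cellE (harmAux (m + 5) x y z F G K) V (m + 4 - i) i),
    sum_arc' m (fun i => cellE (harmAux (m + 5) x y z F G K) V 0 i)]
  have h1 : ∑ i ∈ Finset.range (m + 1), cellE (harmAux (m + 5) x y z F G K) V (i + 2) 0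
      = F * (V 2 0 - V (m + 3) 0) := by
    have : ∀ i ∈ Finset.range (m + 1), cellE (harmAux (m + 5) x y z F G K) V (i + 2) 0
        = F * V (i + 2) 0 - F * V (i + 1 + 2) 0 := by
      intro i hi
      have hi' : i < m + 1 := Finset.mem_range.1 hi
      have e1 : harmAux (m + 5) x y z F G K (i + 2) 0 =
          x - (5 / 9) * (2 * F + G) - (2 / 3) * i * F := by
        unfold harmAux sideOut
        rw [if_pos rfl, if_neg (by omega), if_neg (by omega), if_neg (by omega), if_neg (by omega)]
        push_cast; ring
      have e2 : harmAux (m + 5) x y z F G K (i + 2 + 1) 0 =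
          x - (5 / 9) * (2 * F + G) - (2 / 3) * (i + 1) * F := by
        by_cases hm : i = m
        · subst hm
          unfold harmAux sideOut
          rw [if_pos rfl, if_neg (by omega), if_neg (by omega), if_neg (by omega),
            if_neg (by omega)]
          push_cast; ring
        · unfold harmAux sideOut
          rw [if_pos rfl, if_neg (by omega), if_neg (by omega), if_neg (by omega),
            if_neg (by omega)]
          push_cast; ring
      have e3 : harmAux (m + 5) x y z F G K (i + 2) (0 + 1) =
          x - (5 / 9) * (2 * F + G) - (2 / 3) * i * F - F / 3 := by
        unfold harmAux sideIn
        rw [if_neg (by omega), if_neg (by omega), if_neg (by omega), if_pos (by omega),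
          if_neg (by omega), if_neg (by omega)]
        push_cast; ring
      simp only [cellE, tri, e1, e2, e3]
      rw [show i + 2 + 1 = i + 1 + 2 by ring]
      ring
    rw [Finset.sum_congr rfl this, Finset.sum_range_sub' (fun i => F * V (i + 2) 0)]
    simp only [zero_add, show m + 1 + 2 = m + 3 by ring]
    ring
  have h2 : ∑ i ∈ Finset.range (m + 1), cellE (harmAux (m + 5) x y z F G K) V 0 (i + 2)
      = G * (V 0 2 - V 0 (m + 3)) := by
    have : ∀ i ∈ Finset.range (m + 1), cellE (harmAux (m + 5) x y z F G K) V 0 (i + 2)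
        = G * V 0 (i + 2) - G * V 0 (i + 1 + 2) := by
      intro i hi
      have hi' : i < m + 1 := Finset.mem_range.1 hi
      have e1 : harmAux (m + 5) x y z F G K 0 (i + 2) =
          x - (5 / 9) * (2 * G + F) - (2 / 3) * i * G := by
        unfold harmAux sideOut
        rw [if_neg (by omega), if_pos rfl, if_neg (by omega), if_neg (by omega), if_neg (by omega),
          if_neg (by omega)]
        push_cast; ring
      have e2 : harmAux (m + 5) x y z F G K 0 (i + 2 + 1) =
          x - (5 / 9) * (2 * G + F) - (2 / 3) * (i + 1) * G := by
        unfold harmAux sideOut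
        rw [if_neg (by omega), if_pos rfl, if_neg (by omega), if_neg (by omega), if_neg (by omega),
          if_neg (by omega)]
        push_cast; ring
      have e3 : harmAux (m + 5) x y z F G K (0 + 1) (i + 2) =
          x - (5 / 9) * (2 * G + F) - (2 / 3) * i * G - G / 3 := by
        unfold harmAux sideIn
        rw [if_neg (by omega), if_neg (by omega), if_neg (by omega), if_neg (by omega),
          if_pos (by omega), if_neg (by omega), if_neg (by omega)]
        push_cast; ring
      simp only [cellE, tri, e1, e2, e3]
      rw [show i + 2 + 1 = i + 1 + 2 by ring]
      ring
    rw [Finset.sum_congr rfl this, Finset.sum_range_sub' (fun i => G * V 0 (i + 2))]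
    simp only [zero_add, show m + 1 + 2 = m + 3 by ring]
    ring
  have h3 : ∑ i ∈ Finset.range (m + 1),
      cellE (harmAux (m + 5) x y z F G K) V (m + 4 - (i + 2)) (i + 2)
      = K * (V (m + 3) 2 - V 2 (m + 3)) := by
    have : ∀ i ∈ Finset.range (m + 1),
        cellE (harmAux (m + 5) x y z F G K) V (m + 4 - (i + 2)) (i + 2)
        = K * V (m + 3 - i) (i + 2) - K * V (m + 3 - (i + 1)) (i + 1 + 2) := by
      intro i hi
      have hi' : i < m + 1 := Finset.mem_range.1 hi
      have e1 : harmAux (m + 5) x y z F G K (m + 4 - (i + 2) + 1) (i + 2) =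
          y - (5 / 9) * (2 * K - F) - (2 / 3) * i * K := by
        unfold harmAux sideOut
        rw [if_neg (by omega), if_neg (by omega), if_pos (by omega), if_neg (by omega),
          if_neg (by omega), if_neg (by omega), if_neg (by omega)]
        push_cast; ring
      have e2 : harmAux (m + 5) x y z F G K (m + 4 - (i + 2)) (i + 2 + 1) =
          y - (5 / 9) * (2 * K - F) - (2 / 3) * (i + 1) * K := by
        unfold harmAux sideOut
        rw [if_neg (by omega), if_neg (by omega), if_pos (by omega), if_neg (by omega),
          if_neg (by omega), if_neg (by omega), if_neg (by omega)]
        push_cast; ring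
      have e3 : harmAux (m + 5) x y z F G K (m + 4 - (i + 2)) (i + 2) =
          y - (5 / 9) * (2 * K - F) - (2 / 3) * i * K - K / 3 := by
        unfold harmAux sideIn
        rw [if_neg (by omega), if_neg (by omega), if_neg (by omega), if_neg (by omega),
          if_neg (by omega), if_neg (by omega), if_neg (by omega)]
        push_cast; ring
      simp only [cellE, tri, e1, e2, e3]
      rw [show i + 2 + 1 = i + 1 + 2 by ring, show m + 4 - (i + 2) + 1 = m + 3 - i by omega,
        show m + 4 - (i + 2) = m + 3 - (i + 1) by omega]
      ring
    rw [Finset.sum_congr rfl this,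
      Finset.sum_range_sub' (fun i => K * V (m + 3 - i) (i + 2))]
    simp only [zero_add, show m + 1 + 2 = m + 3 by ring, show m + 3 - (m + 1) = 2 by omega,
      Nat.sub_zero]
    ring
  rw [h1, h2, h3]
  have t1 : m + 4 - 0 = m + 4 := rfl
  have t2 : m + 4 - 1 = m + 3 := rfl
  have t3 : m + 4 - (m + 3) = 1 := by omega
  rw [t1, t2, t3]
  simp only [cellE, tri, zero_add]
  have v00 : harmAux (m + 5) x y z F G K 0 0 = x := by simp [harmAux, sideOut]
  have v10 : harmAux (m + 5) x y z F G K 1 0 = x - (5 * F + 4 * G) / 9 := by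
    simp [harmAux, sideOut]
  have v01 : harmAux (m + 5) x y z F G K 0 1 = x - (5 * G + 4 * F) / 9 := by
    simp [harmAux, sideOut]
  have v11 : harmAux (m + 5) x y z F G K 1 1 = x - (2 / 3) * (F + G) := by
    simp [harmAux, sideIn]
  have v20 : harmAux (m + 5) x y z F G K (1 + 1) 0 = x - (5 / 9) * (2 * F + G) := by
    simp [harmAux, sideOut]
  have v02 : harmAux (m + 5) x y z F G K 0 (1 + 1) = x - (5 / 9) * (2 * G + F) := by
    simp [harmAux, sideOut]
  have w00 : harmAux (m + 5) x y z F G K (m + 4 + 1) 0 = y := by simp [harmAux, sideOut]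
  have w10 : harmAux (m + 5) x y z F G K (m + 4) 0 = y - (5 * (-F) + 4 * K) / 9 := by
    simp [harmAux, sideOut]
  have w10' : harmAux (m + 5) x y z F G K (m + 3 + 1) 0 = y - (5 * (-F) + 4 * K) / 9 := w10
  have w01 : harmAux (m + 5) x y z F G K (m + 4) 1 = y - (5 * K + 4 * (-F)) / 9 := by
    simp [harmAux, sideOut]
  have w01' : harmAux (m + 5) x y z F G K (m + 3 + 1) 1 = y - (5 * K + 4 * (-F)) / 9 := w01
  have w11 : harmAux (m + 5) x y z F G K (m + 3) 1 = y - (2 / 3) * (-F + K) := by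
    simp [harmAux, sideIn]
  have w20 : harmAux (m + 5) x y z F G K (m + 3) 0 = y - (5 / 9) * (2 * (-F) + K) := by
    simp [harmAux, sideOut]
    subst hy hz hK; push_cast; ring
  have w02 : harmAux (m + 5) x y z F G K (m + 3) (1 + 1) = y - (5 / 9) * (2 * K - F) := by
    simp [harmAux, sideOut, show m + 3 + 2 = m + 5 by ring]
    ring
  have u00 : harmAux (m + 5) x y z F G K 0 (m + 4 + 1) = z := by simp [harmAux, sideOut]
  have u10 : harmAux (m + 5) x y z F G K 0 (m + 4) = z - (5 * (-G) + 4 * (-K)) / 9 := by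
    simp [harmAux, sideOut]
  have u10' : harmAux (m + 5) x y z F G K 0 (m + 3 + 1) = z - (5 * (-G) + 4 * (-K)) / 9 := u10
  have u01 : harmAux (m + 5) x y z F G K 1 (m + 4) = z - (5 * (-K) + 4 * (-G)) / 9 := by
    simp [harmAux, sideOut, show 1 + (m + 4) = m + 5 by ring]
  have u01' : harmAux (m + 5) x y z F G K 1 (m + 3 + 1) = z - (5 * (-K) + 4 * (-G)) / 9 := u01
  have u11 : harmAux (m + 5) x y z F G K 1 (m + 3) = z - (2 / 3) * (-G - K) := by
    unfold harmAux sideIn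
    rw [if_neg (by omega), if_neg (by omega), if_neg (by omega), if_neg (by omega), if_pos rfl,
      if_neg (by omega), if_pos (by omega)]
    ring
  have u20 : harmAux (m + 5) x y z F G K 0 (m + 3) = z - (5 / 9) * (2 * (-G) - K) := by
    simp [harmAux, sideOut]
    subst hy hz hK; push_cast; ring
  have u02 : harmAux (m + 5) x y z F G K (1 + 1) (m + 3) = z - (5 / 9) * (2 * (-K) - G) := by
    simp [harmAux, sideOut, show 2 + (m + 3) = m + 5 by ring]
    subst hy hz hK; push_cast; ring
  rw [v00, v10, v01, v11, v20, v02, w00, w10, w01, w11, w20, w02, u00, u10, u01, u11, u20, u02]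
  simp only [show m + 4 + 1 = m + 5 by ring, show m + 3 + 1 = m + 4 by ring,
    show 1 + 1 = 2 by rfl]
  subst hK
  ring

lemma rl_pos (l : ℕ) : 0 < rl l := by
  unfold rl; positivity

lemma harm_key {l : ℕ} (hl : 5 ≤ l) (x y z : ℝ) (V : ℕ → ℕ → ℝ) :
    ∑ i ∈ Sf l, cellE (harm l x y z) V i.1 i.2 =
      rl l * tri x y z (V 0 0) (V l 0) (V 0 l) := by
  obtain ⟨m, rfl⟩ := Nat.exists_eq_add_of_le' hl
  have hr : (2 * ((m + 5 : ℕ) : ℝ) / 3 + 1 / 9) * rl (m + 5) = 1 := by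
    unfold rl
    apply mul_inv_cancel₀
    positivity
  have := harmAux_key m x y z (rl (m + 5) * (x - y)) (rl (m + 5) * (x - z))
    (rl (m + 5) * (y - z)) V
    (by rw [← mul_assoc, hr]; ring) (by rw [← mul_assoc, hr]; ring) (by ring)
  unfold harm
  rw [this]
  unfold tri
  ring

lemma harm_corner0 {l : ℕ} (hl : 5 ≤ l) (x y z : ℝ) : harm l x y z 0 0 = x := by
  simp [harm, harmAux, sideOut]

lemma harm_corner1 {l : ℕ} (hl : 5 ≤ l) (x y z : ℝ) : harm l x y z l 0 = y := by
  unfold harm harmAux sideOut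
  rw [if_pos rfl, if_neg (by omega), if_neg (by omega), if_neg (by omega), if_pos rfl]

lemma harm_corner2 {l : ℕ} (hl : 5 ≤ l) (x y z : ℝ) : harm l x y z 0 l = z := by
  unfold harm harmAux sideOut
  rw [if_neg (by omega), if_pos rfl, if_neg (by omega), if_neg (by omega), if_neg (by omega),
    if_pos rfl]

lemma sum_cellE_nonneg (l : ℕ) (V : ℕ → ℕ → ℝ) : 0 ≤ ∑ i ∈ Sf l, cellE V V i.1 i.2 := by
  apply Finset.sum_nonneg
  intro i _
  simp only [cellE, tri]
  nlinarith [mul_self_nonneg (V i.1 i.2 - V (i.1 + 1) i.2),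
    mul_self_nonneg (V i.1 i.2 - V i.1 (i.2 + 1)),
    mul_self_nonneg (V (i.1 + 1) i.2 - V i.1 (i.2 + 1))]

/-- Energy lower bound. -/
lemma lower_key {l : ℕ} (hl : 5 ≤ l) (V : ℕ → ℕ → ℝ) :
    rl l * tri (V 0 0) (V l 0) (V 0 l) (V 0 0) (V l 0) (V 0 l) ≤
      ∑ i ∈ Sf l, cellE V V i.1 i.2 := by
  set h := harm l (V 0 0) (V l 0) (V 0 l) with hh
  have h1 := harm_key hl (V 0 0) (V l 0) (V 0 l) V
  have h2 := harm_key hl (V 0 0) (V l 0) (V 0 l) h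
  rw [← hh] at h1 h2
  have h3 := sum_cellE_nonneg l (fun a b => V a b - h a b)
  have h4 : ∑ i ∈ Sf l, cellE (fun a b => V a b - h a b) (fun a b => V a b - h a b) i.1 i.2
      = ∑ i ∈ Sf l, cellE V V i.1 i.2 - 2 * ∑ i ∈ Sf l, cellE h V i.1 i.2
        + ∑ i ∈ Sf l, cellE h h i.1 i.2 := by
    rw [Finset.mul_sum, ← Finset.sum_sub_distrib, ← Finset.sum_add_distrib]
    apply Finset.sum_congr rfl
    intro i _
    simp only [cellE, tri]
    ring
  have c0 : h 0 0 = V 0 0 := harm_corner0 hl _ _ _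
  have c1 : h l 0 = V l 0 := harm_corner1 hl _ _ _
  have c2 : h 0 l = V 0 l := harm_corner2 hl _ _ _
  rw [c0, c1, c2] at h2
  linarith

/-! ### Coordinates, words -/

def PP (q : Fin 3 → E2) (s t : ℝ) : E2 := q 0 + s • (q 1 - q 0) + t • (q 2 - q 0)

lemma PP_00 (q : Fin 3 → E2) : PP q 0 0 = q 0 := by simp [PP]
lemma PP_10 (q : Fin 3 → E2) : PP q 1 0 = q 1 := by simp [PP]
lemma PP_01 (q : Fin 3 → E2) : PP q 0 1 = q 2 := by simp [PP]

lemma fmap_PP (q : Fin 3 → E2) (l : ℕ) (i : ℕ × ℕ) (s t : ℝ) :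
    fmap q l i (PP q s t) = PP q ((i.1 + s) / l) ((i.2 + t) / l) := by
  unfold fmap PP
  rw [div_eq_mul_inv, div_eq_mul_inv, div_eq_mul_inv, div_eq_mul_inv]
  module

lemma PP_inj (q : Fin 3 → E2) (hq : ∀ j k : Fin 3, j ≠ k → dist (q j) (q k) = 1)
    {s t s' t' : ℝ} (h : PP q s t = PP q s' t') : s = s' ∧ t = t' := by
  have h1 : (s - s') • (q 1 - q 0) + (t - t') • (q 2 - q 0) = 0 := by
    have : PP q s t - PP q s' t' = 0 := sub_eq_zero.2 h
    rw [← this]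
    unfold PP
    module
  have e1 : ‖q 1 - q 0‖ = 1 := by rw [← dist_eq_norm]; exact hq _ _ (by decide)
  have e2 : ‖q 2 - q 0‖ = 1 := by rw [← dist_eq_norm]; exact hq _ _ (by decide)
  have e3 : ‖(q 1 - q 0) - (q 2 - q 0)‖ = 1 := by
    rw [sub_sub_sub_cancel_right, ← dist_eq_norm]; exact hq _ _ (by decide)
  have e4 := norm_sub_sq_real (q 1 - q 0) (q 2 - q 0)
  rw [e1, e2, e3] at e4
  have e5 := norm_add_sq_real ((s - s') • (q 1 - q 0)) ((t - t') • (q 2 - q 0))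
  rw [h1, norm_smul, norm_smul, e1, e2, real_inner_smul_left, real_inner_smul_right,
    norm_zero, mul_one, mul_one, Real.norm_eq_abs, Real.norm_eq_abs, sq_abs, sq_abs] at e5
  have e6 : inner ℝ (q 1 - q 0) (q 2 - q 0) = (1 / 2 : ℝ) := by linarith
  rw [e6] at e5
  have f1 : (t - t') ^ 2 = 0 := by nlinarith [sq_nonneg ((s - s') + (t - t') / 2), sq_nonneg (t - t')]
  have f2 : (s - s') ^ 2 = 0 := by nlinarith [sq_nonneg ((t - t') + (s - s') / 2), sq_nonneg (s - s')]
  have f1' := pow_eq_zero_iff (two_ne_zero) |>.1 f1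
  have f2' := pow_eq_zero_iff (two_ne_zero) |>.1 f2
  constructor <;> linarith

/-- Integer address of a word. -/
def addr (l : ℕ → ℕ) (w : ℕ → ℕ × ℕ) : ℕ → ℕ × ℕ
  | 0 => (0, 0)
  | n + 1 => (l n * (addr l w n).1 + (w n).1, l n * (addr l w n).2 + (w n).2)

lemma wordMap_PP (q : Fin 3 → E2) (l : ℕ → ℕ) (hl : ∀ n, 5 ≤ l n) (w : ℕ → ℕ × ℕ) (n : ℕ) :
    ∀ s t : ℝ, wordMap q l w n (PP q s t) =
      PP q (((addr l w n).1 + s) / (Ln l n)) (((addr l w n).2 + t) / (Ln l n)) := by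
  induction n with
  | zero => intro s t; simp [wordMap, addr, Ln]
  | succ n ih =>
    intro s t
    have : ((l n : ℕ) : ℝ) ≠ 0 := by
      have := hl n
      positivity
    simp only [wordMap, Function.comp, fmap_PP, ih, addr]
    have hL : (Ln l (n + 1) : ℝ) = Ln l n * l n := by
      simp [Ln, Finset.prod_range_succ]
    rw [hL]
    push_cast
    congr 1
    · rw [mul_comm (Ln l n : ℝ), ← div_div]
      congr 1
      field_simp
      ring
    · rw [mul_comm (Ln l n : ℝ), ← div_div]
      congr 1
      field_simp
      ring

lemma Ln_pos (l : ℕ → ℕ) (hl : ∀ n, 5 ≤ l n) (n : ℕ) : (0 : ℝ) < Ln l n := by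
  have : 0 < Ln l n := Finset.prod_pos (fun k _ => by have := hl k; omega)
  exact_mod_cast this

lemma wordMap_congr (q : Fin 3 → E2) (l : ℕ → ℕ) (w w' : ℕ → ℕ × ℕ) (n : ℕ)
    (h : ∀ k < n, w k = w' k) : wordMap q l w n = wordMap q l w' n := by
  induction n with
  | zero => rfl
  | succ n ih =>
    simp only [wordMap]
    rw [ih (fun k hk => h k (by omega)), h n (by omega)]

lemma wordMap_update (q : Fin 3 → E2) (l : ℕ → ℕ) (w : ℕ → ℕ × ℕ) (n : ℕ) (i : ℕ × ℕ) :
    wordMap q l (Function.update w n i) (n + 1) = wordMap q l w n ∘ fmap q (l n) i := by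
  simp only [wordMap]
  rw [wordMap_congr q l (Function.update w n i) w n
    (fun k hk => Function.update_of_ne (by omega) _ _), Function.update_self]

open Classical in
/-- Words as a finset. -/
def Wf (l : ℕ → ℕ) : ℕ → Finset (ℕ → ℕ × ℕ)
  | 0 => {fun _ => (0, 0)}
  | n + 1 => (Wf l n ×ˢ Sf (l n)).image (fun p => Function.update p.1 n p.2)

lemma mem_Wf (l : ℕ → ℕ) (hl : ∀ n, 5 ≤ l n) (n : ℕ) :
    ∀ w, w ∈ Wf l n ↔ w ∈ Wn l n := by
  induction n with
  | zero =>
    intro w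
    simp only [Wf, Finset.mem_singleton, Wn, Set.mem_ofPred_eq]
    constructor
    · rintro rfl; simp
    · intro h; funext k; exact h.2 k (by omega)
  | succ n ih =>
    intro w
    simp only [Wf, Finset.mem_image, Finset.mem_product, Prod.exists]
    constructor
    · rintro ⟨v, a, b, ⟨hv, hi⟩, rfl⟩
      rw [ih] at hv
      rw [mem_Sf (hl n)] at hi
      refine ⟨fun k hk => ?_, fun k hk => ?_⟩
      · by_cases h : k = n
        · subst h; rw [Function.update_self]; exact hi
        · rw [Function.update_of_ne h]; exact hv.1 k (by omega)
      · rw [Function.update_of_ne (by omega)]; exact hv.2 k (by omega)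
    · intro h
      refine ⟨Function.update w n (0, 0), (w n).1, (w n).2, ⟨?_, ?_⟩, ?_⟩
      · rw [ih]
        refine ⟨fun k hk => ?_, fun k hk => ?_⟩
        · rw [Function.update_of_ne (by omega)]; exact h.1 k (by omega)
        · by_cases h' : k = n
          · subst h'; rw [Function.update_self]
          · rw [Function.update_of_ne h']; exact h.2 k (by omega)
      · rw [mem_Sf (hl n)]; exact h.1 n (by omega)
      · simp

lemma sum_Wf_succ (l : ℕ → ℕ) (hl : ∀ n, 5 ≤ l n) (n : ℕ) (φ : (ℕ → ℕ × ℕ) → ℝ) :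
    ∑ w ∈ Wf l (n + 1), φ w = ∑ w ∈ Wf l n, ∑ i ∈ Sf (l n), φ (Function.update w n i) := by
  classical
  simp only [Wf]
  rw [Finset.sum_image, Finset.sum_product]
  rintro ⟨v, i⟩ hv ⟨v', i'⟩ hv' h
  simp only [Finset.coe_product, Set.mem_prod, Finset.mem_coe] at hv hv'
  have h1 := (mem_Wf l hl n v).1 hv.1
  have h2 := (mem_Wf l hl n v').1 hv'.1
  simp only at h
  have hi : i = i' := by
    have := congrFun h n
    simpa using this
  have hvv : v = v' := by
    funext k
    by_cases hk : k = n
    · subst hk; rw [h1.2 k le_rfl, h2.2 k le_rfl]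
    · have := congrFun h k
      simpa [Function.update_of_ne hk] using this
  rw [hi, hvv]

lemma En_eq (q : Fin 3 → E2) (l : ℕ → ℕ) (hl : ∀ n, 5 ≤ l n) (n : ℕ) (u v : E2 → ℝ) :
    En q l n u v = (Rn l n)⁻¹ *
      ∑ w ∈ Wf l n, E0 q (u ∘ wordMap q l w n) (v ∘ wordMap q l w n) := by
  have : Wn l n = (Wf l n : Set (ℕ → ℕ × ℕ)) := by
    ext w; rw [Finset.mem_coe, mem_Wf l hl]
  unfold En
  rw [this, finsum_mem_coe_finset]

lemma E0_eq (q : Fin 3 → E2) (u v : E2 → ℝ) :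
    E0 q u v = tri (u (q 0)) (u (q 1)) (u (q 2)) (v (q 0)) (v (q 1)) (v (q 2)) := by
  simp only [E0, Fin.sum_univ_three, tri]
  ring

/-- Lattice function of `u` in the cell of `w`. -/
def lat (q : Fin 3 → E2) (l : ℕ → ℕ) (n : ℕ) (w : ℕ → ℕ × ℕ) (u : E2 → ℝ) (a b : ℕ) : ℝ :=
  u (wordMap q l w n (PP q ((a : ℝ) / l n) ((b : ℝ) / l n)))

lemma l_ne (l : ℕ → ℕ) (hl : ∀ n, 5 ≤ l n) (n : ℕ) : ((l n : ℕ) : ℝ) ≠ 0 := by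
  have := hl n
  positivity

lemma lat_00 (q : Fin 3 → E2) (l : ℕ → ℕ) (n : ℕ) (w : ℕ → ℕ × ℕ)
    (u : E2 → ℝ) : lat q l n w u 0 0 = u (wordMap q l w n (q 0)) := by
  simp [lat, PP_00]

lemma lat_l0 (q : Fin 3 → E2) (l : ℕ → ℕ) (hl : ∀ n, 5 ≤ l n) (n : ℕ) (w : ℕ → ℕ × ℕ)
    (u : E2 → ℝ) : lat q l n w u (l n) 0 = u (wordMap q l w n (q 1)) := by
  simp [lat, PP_10, div_self (l_ne l hl n)]

lemma lat_0l (q : Fin 3 → E2) (l : ℕ → ℕ) (hl : ∀ n, 5 ≤ l n) (n : ℕ) (w : ℕ → ℕ × ℕ)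
    (u : E2 → ℝ) : lat q l n w u 0 (l n) = u (wordMap q l w n (q 2)) := by
  simp [lat, PP_01, div_self (l_ne l hl n)]

lemma E0_word (q : Fin 3 → E2) (l : ℕ → ℕ) (hl : ∀ n, 5 ≤ l n) (n : ℕ) (w : ℕ → ℕ × ℕ)
    (u v : E2 → ℝ) : E0 q (u ∘ wordMap q l w n) (v ∘ wordMap q l w n) =
      tri (lat q l n w u 0 0) (lat q l n w u (l n) 0) (lat q l n w u 0 (l n))
        (lat q l n w v 0 0) (lat q l n w v (l n) 0) (lat q l n w v 0 (l n)) := by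
  rw [E0_eq, lat_00, lat_l0 q l hl, lat_0l q l hl, lat_00, lat_l0 q l hl, lat_0l q l hl]
  rfl

lemma fmap_q0 (q : Fin 3 → E2) (l : ℕ) (i : ℕ × ℕ) :
    fmap q l i (q 0) = PP q ((i.1 : ℝ) / l) ((i.2 : ℝ) / l) := by
  conv_lhs => rw [← PP_00 q]
  rw [fmap_PP]; simp

lemma fmap_q1 (q : Fin 3 → E2) (l : ℕ) (i : ℕ × ℕ) :
    fmap q l i (q 1) = PP q (((i.1 + 1 : ℕ) : ℝ) / l) ((i.2 : ℝ) / l) := by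
  conv_lhs => rw [← PP_10 q]
  rw [fmap_PP]; simp

lemma fmap_q2 (q : Fin 3 → E2) (l : ℕ) (i : ℕ × ℕ) :
    fmap q l i (q 2) = PP q ((i.1 : ℝ) / l) (((i.2 + 1 : ℕ) : ℝ) / l) := by
  conv_lhs => rw [← PP_01 q]
  rw [fmap_PP]; simp

lemma E0_word_succ (q : Fin 3 → E2) (l : ℕ → ℕ) (n : ℕ) (w : ℕ → ℕ × ℕ) (i : ℕ × ℕ)
    (u v : E2 → ℝ) :
    E0 q (u ∘ wordMap q l (Function.update w n i) (n + 1))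
      (v ∘ wordMap q l (Function.update w n i) (n + 1)) =
      cellE (lat q l n w u) (lat q l n w v) i.1 i.2 := by
  rw [E0_eq, wordMap_update]
  simp only [Function.comp, fmap_q0, fmap_q1, fmap_q2, cellE, lat]

lemma Rn_pos (l : ℕ → ℕ) (n : ℕ) : 0 < Rn l n :=
  Finset.prod_pos (fun _ _ => rl_pos _)

lemma Rn_succ (l : ℕ → ℕ) (n : ℕ) : Rn l (n + 1) = Rn l n * rl (l n) := by
  simp [Rn, Finset.prod_range_succ]

lemma En_succ (q : Fin 3 → E2) (l : ℕ → ℕ) (hl : ∀ n, 5 ≤ l n) (n : ℕ) (u v : E2 → ℝ) :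
    En q l (n + 1) u v = (Rn l n)⁻¹ * ∑ w ∈ Wf l n, (rl (l n))⁻¹ *
      ∑ i ∈ Sf (l n), cellE (lat q l n w u) (lat q l n w v) i.1 i.2 := by
  rw [En_eq q l hl, sum_Wf_succ l hl, Rn_succ, mul_inv, mul_assoc, Finset.mul_sum]
  congr 1
  apply Finset.sum_congr rfl
  intro w _
  congr 1
  apply Finset.sum_congr rfl
  intro i _
  rw [E0_word_succ]

lemma tri_self_nonneg (x y z : ℝ) : 0 ≤ tri x y z x y z := by
  unfold tri
  nlinarith [mul_self_nonneg (x - y), mul_self_nonneg (x - z), mul_self_nonneg (y - z)]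

lemma E0_nonneg (q : Fin 3 → E2) (u : E2 → ℝ) : 0 ≤ E0 q u u := by
  rw [E0_eq]; exact tri_self_nonneg _ _ _

lemma En_nonneg (q : Fin 3 → E2) (l : ℕ → ℕ) (hl : ∀ n, 5 ≤ l n) (n : ℕ) (u : E2 → ℝ) :
    0 ≤ En q l n u u := by
  rw [En_eq q l hl]
  exact mul_nonneg (inv_nonneg.2 (Rn_pos l n).le) (Finset.sum_nonneg fun w _ => E0_nonneg _ _)

lemma En_le_succ (q : Fin 3 → E2) (l : ℕ → ℕ) (hl : ∀ n, 5 ≤ l n) (n : ℕ) (u : E2 → ℝ) :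
    En q l n u u ≤ En q l (n + 1) u u := by
  rw [En_eq q l hl, En_succ q l hl]
  apply mul_le_mul_of_nonneg_left _ (inv_nonneg.2 (Rn_pos l n).le)
  apply Finset.sum_le_sum
  intro w _
  rw [E0_word q l hl, le_inv_mul_iff₀ (rl_pos _)]
  exact lower_key (hl n) _

lemma En_mono (q : Fin 3 → E2) (l : ℕ → ℕ) (hl : ∀ n, 5 ≤ l n) (u : E2 → ℝ) :
    Monotone (fun n => En q l n u u) :=
  monotone_nat_of_le_succ (fun n => En_le_succ q l hl n u)

/-! ### Harmonic extension in space -/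

open Classical in
def hext (q : Fin 3 → E2) (l : ℕ → ℕ) (n : ℕ) (u : E2 → ℝ) (x : E2) : ℝ :=
  if h : ∃ p : (ℕ → ℕ × ℕ) × (ℕ × ℕ), p.2.1 + p.2.2 ≤ l n ∧
      x = wordMap q l p.1 n (PP q ((p.2.1 : ℝ) / l n) ((p.2.2 : ℝ) / l n))
  then harm (l n) (u (wordMap q l h.choose.1 n (q 0))) (u (wordMap q l h.choose.1 n (q 1)))
    (u (wordMap q l h.choose.1 n (q 2))) h.choose.2.1 h.choose.2.2
  else 0

lemma arith_aux {l A A' B B' a a' b b' : ℕ} (hl : 5 ≤ l) (h : a + b ≤ l) (h' : a' + b' ≤ l)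
    (h1 : l * A + a = l * A' + a') (h2 : l * B + b = l * B' + b') :
    (A = A' ∧ B = B' ∧ a = a' ∧ b = b') ∨
    (((a = 0 ∧ b = 0) ∨ (a = l ∧ b = 0) ∨ (a = 0 ∧ b = l)) ∧
      ((a' = 0 ∧ b' = 0) ∨ (a' = l ∧ b' = 0) ∨ (a' = 0 ∧ b' = l))) := by
  have key : ∀ A A' a a' : ℕ, a ≤ l → a' ≤ l → l * A + a = l * A' + a' →
      (A = A' ∧ a = a') ∨ (a = l ∧ a' = 0) ∨ (a = 0 ∧ a' = l) := by
    intro A A' a a' ha ha' h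
    rcases lt_trichotomy A A' with hA | hA | hA
    · obtain ⟨d, rfl⟩ := Nat.exists_eq_add_of_lt hA
      right; left
      have : l * (A + d + 1) = l * A + l * d + l := by ring
      rw [this] at h
      have : 0 ≤ l * d := Nat.zero_le _
      omega
    · subst hA; left; exact ⟨rfl, by omega⟩
    · obtain ⟨d, rfl⟩ := Nat.exists_eq_add_of_lt hA
      right; right
      have : l * (A' + d + 1) = l * A' + l * d + l := by ring
      rw [this] at h
      have : 0 ≤ l * d := Nat.zero_le _
      omega
  have k1 := key A A' a a' (by omega) (by omega) h1
  have k2 := key B B' b b' (by omega) (by omega) h2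
  omega

lemma lattice_inj (q : Fin 3 → E2) (hq : ∀ j k : Fin 3, j ≠ k → dist (q j) (q k) = 1)
    (l : ℕ → ℕ) (hl : ∀ n, 5 ≤ l n) (n : ℕ) (w w' : ℕ → ℕ × ℕ) (a b a' b' : ℕ)
    (h : wordMap q l w n (PP q ((a : ℝ) / l n) ((b : ℝ) / l n)) =
      wordMap q l w' n (PP q ((a' : ℝ) / l n) ((b' : ℝ) / l n))) :
    l n * (addr l w n).1 + a = l n * (addr l w' n).1 + a' ∧
    l n * (addr l w n).2 + b = l n * (addr l w' n).2 + b' := by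
  rw [wordMap_PP q l hl, wordMap_PP q l hl] at h
  obtain ⟨h1, h2⟩ := PP_inj q hq h
  have hL := (Ln_pos l hl n).ne'
  have hn := l_ne l hl n
  field_simp at h1 h2
  constructor
  · have h3 : ((l n * (addr l w n).1 + a : ℕ) : ℝ) = ((l n * (addr l w' n).1 + a' : ℕ) : ℝ) := by
      push_cast; linarith
    exact_mod_cast h3
  · have h3 : ((l n * (addr l w n).2 + b : ℕ) : ℝ) = ((l n * (addr l w' n).2 + b' : ℕ) : ℝ) := by
      push_cast; linarith
    exact_mod_cast h3

/-- At a corner, the harmonic value is the original value. -/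
lemma harm_at_corner (q : Fin 3 → E2) (l : ℕ → ℕ) (hl : ∀ n, 5 ≤ l n) (n : ℕ) (u : E2 → ℝ)
    (w : ℕ → ℕ × ℕ) (a b : ℕ)
    (h : (a = 0 ∧ b = 0) ∨ (a = l n ∧ b = 0) ∨ (a = 0 ∧ b = l n)) :
    harm (l n) (u (wordMap q l w n (q 0))) (u (wordMap q l w n (q 1)))
      (u (wordMap q l w n (q 2))) a b = lat q l n w u a b := by
  rcases h with ⟨rfl, rfl⟩ | ⟨rfl, rfl⟩ | ⟨rfl, rfl⟩
  · rw [harm_corner0 (hl n), lat_00]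
  · rw [harm_corner1 (hl n), lat_l0 q l hl]
  · rw [harm_corner2 (hl n), lat_0l q l hl]

lemma ext_eq (q : Fin 3 → E2) (hq : ∀ j k : Fin 3, j ≠ k → dist (q j) (q k) = 1)
    (l : ℕ → ℕ) (hl : ∀ n, 5 ≤ l n) (n : ℕ) (u : E2 → ℝ) (w : ℕ → ℕ × ℕ) (a b : ℕ)
    (hab : a + b ≤ l n) :
    lat q l n w (hext q l n u) a b =
      harm (l n) (u (wordMap q l w n (q 0))) (u (wordMap q l w n (q 1)))
        (u (wordMap q l w n (q 2))) a b := by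
  have h : ∃ p : (ℕ → ℕ × ℕ) × (ℕ × ℕ), p.2.1 + p.2.2 ≤ l n ∧
      wordMap q l w n (PP q ((a : ℝ) / l n) ((b : ℝ) / l n)) =
        wordMap q l p.1 n (PP q ((p.2.1 : ℝ) / l n) ((p.2.2 : ℝ) / l n)) :=
    ⟨(w, (a, b)), hab, rfl⟩
  unfold lat hext
  rw [dif_pos h]
  obtain ⟨h1, h2⟩ := h.choose_spec
  generalize h.choose = p at h1 h2
  obtain ⟨w', a', b'⟩ := p
  simp only at h1 h2 ⊢
  obtain ⟨k1, k2⟩ := lattice_inj q hq l hl n w w' a b a' b' h2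
  rcases arith_aux (hl n) hab h1 k1 k2 with ⟨e1, e2, e3, e4⟩ | ⟨e1, e2⟩
  · have : ∀ s t : ℝ, wordMap q l w n (PP q s t) = wordMap q l w' n (PP q s t) := by
      intro s t
      rw [wordMap_PP q l hl, wordMap_PP q l hl, e1, e2]
    have t0 := this 0 0
    have t1 := this 1 0
    have t2 := this 0 1
    rw [PP_00] at t0
    rw [PP_10] at t1
    rw [PP_01] at t2
    rw [t0, t1, t2, e3, e4]
  · rw [harm_at_corner q l hl n u w a b e1, harm_at_corner q l hl n u w' a' b' e2]
    unfold lat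
    rw [h2]

lemma ext_on_Vn (q : Fin 3 → E2) (hq : ∀ j k : Fin 3, j ≠ k → dist (q j) (q k) = 1)
    (l : ℕ → ℕ) (hl : ∀ n, 5 ≤ l n) (n : ℕ) (u : E2 → ℝ) (x : E2) (hx : x ∈ Vn q l n) :
    hext q l n u x = u x := by
  simp only [Vn, Set.mem_iUnion, V0, Set.mem_image, Set.mem_range, exists_prop] at hx
  obtain ⟨w, _, _, ⟨j, rfl⟩, rfl⟩ := hx
  have hh := ext_eq q hq l hl n u w
  fin_cases j
  · have := hh 0 0 (by omega)
    rwa [lat_00, harm_corner0 (hl n)] at this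
  · have := hh (l n) 0 (by omega)
    rwa [lat_l0 q l hl, harm_corner1 (hl n)] at this
  · have := hh 0 (l n) (by omega)
    rwa [lat_0l q l hl, harm_corner2 (hl n)] at this

lemma En_ext (q : Fin 3 → E2) (hq : ∀ j k : Fin 3, j ≠ k → dist (q j) (q k) = 1)
    (l : ℕ → ℕ) (hl : ∀ n, 5 ≤ l n) (n : ℕ) (u v : E2 → ℝ) :
    En q l (n + 1) (hext q l n u) v = En q l n u v := by
  rw [En_succ q l hl, En_eq q l hl]
  congr 1
  apply Finset.sum_congr rfl
  intro w _
  rw [E0_word q l hl, inv_mul_eq_iff_eq_mul₀ (rl_pos _).ne', lat_00 q l n w u, lat_l0 q l hl n w u,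
    lat_0l q l hl n w u, ← harm_key (hl n)]
  apply Finset.sum_congr rfl
  rintro ⟨a, b⟩ hi
  rw [mem_Sf (hl n), mem_Sset_iff] at hi
  have := hl n
  simp only [cellE]
  rw [ext_eq q hq l hl n u w _ _ (by omega), ext_eq q hq l hl n u w _ _ (by omega),
    ext_eq q hq l hl n u w _ _ (by omega)]

lemma En_congr (q : Fin 3 → E2) (l : ℕ → ℕ) (hl : ∀ n, 5 ≤ l n) (n : ℕ) (u u' v v' : E2 → ℝ)
    (h : ∀ x ∈ Vn q l n, u x = u' x) (h' : ∀ x ∈ Vn q l n, v x = v' x) :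
    En q l n u v = En q l n u' v' := by
  rw [En_eq q l hl, En_eq q l hl]
  congr 1
  apply Finset.sum_congr rfl
  intro w hw
  have hm : ∀ j, wordMap q l w n (q j) ∈ Vn q l n := by
    intro j
    simp only [Vn, Set.mem_iUnion]
    exact ⟨w, (mem_Wf l hl n w).1 hw, q j, ⟨j, rfl⟩, rfl⟩
  simp only [E0, Function.comp, h _ (hm _), h' _ (hm _)]

lemma mem_Vn_iff (q : Fin 3 → E2) (l : ℕ → ℕ) (n : ℕ) (x : E2) :
    x ∈ Vn q l n ↔ ∃ w ∈ Wn l n, ∃ j, wordMap q l w n (q j) = x := by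
  simp [Vn, V0]

lemma Vn_le_succ (q : Fin 3 → E2) (l : ℕ → ℕ) (hl : ∀ n, 5 ≤ l n) (n : ℕ) :
    Vn q l n ⊆ Vn q l (n + 1) := by
  intro x hx
  rw [mem_Vn_iff] at hx ⊢
  obtain ⟨w, hw, j, rfl⟩ := hx
  have hup : ∀ i ∈ Sset (l n), Function.update w n i ∈ Wn l (n + 1) := by
    intro i hi
    rw [← mem_Wf l hl] at hw ⊢
    simp only [Wf, Finset.mem_image, Finset.mem_product]
    exact ⟨(w, i), ⟨hw, (mem_Sf (hl n) i).2 hi⟩, rfl⟩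
  have := hl n
  have hne := l_ne l hl n
  have hc : (((l n - 1 + 1 : ℕ)) : ℝ) / l n = 1 := by
    rw [Nat.sub_add_cancel (by omega), div_self hne]
  fin_cases j
  · refine ⟨_, hup (0, 0) (by rw [mem_Sset_iff]; omega), 0, ?_⟩
    rw [wordMap_update, Function.comp, fmap_q0]
    simp [PP_00]
  · refine ⟨_, hup (l n - 1, 0) (by rw [mem_Sset_iff]; omega), 1, ?_⟩
    rw [wordMap_update, Function.comp, fmap_q1, hc]
    simp [PP_10]
  · refine ⟨_, hup (0, l n - 1) (by rw [mem_Sset_iff]; omega), 2, ?_⟩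
    rw [wordMap_update, Function.comp, fmap_q2, hc]
    simp [PP_01]

lemma Vn_mono (q : Fin 3 → E2) (l : ℕ → ℕ) (hl : ∀ n, 5 ≤ l n) : Monotone (Vn q l) :=
  monotone_nat_of_le_succ (fun n => Vn_le_succ q l hl n)

/-- Iterated extension. -/
def iext (q : Fin 3 → E2) (l : ℕ → ℕ) (n : ℕ) (g : E2 → ℝ) : ℕ → E2 → ℝ
  | 0 => g
  | m + 1 => hext q l (n + m) (iext q l n g m)

lemma iext_stable (q : Fin 3 → E2) (hq : ∀ j k : Fin 3, j ≠ k → dist (q j) (q k) = 1)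
    (l : ℕ → ℕ) (hl : ∀ n, 5 ≤ l n) (n : ℕ) (g : E2 → ℝ) (m : ℕ) (x : E2)
    (hx : x ∈ Vn q l (n + m)) (k : ℕ) : iext q l n g (m + k) x = iext q l n g m x := by
  induction k with
  | zero => rfl
  | succ k ih =>
    rw [← ih]
    exact ext_on_Vn q hq l hl _ _ x
      (Vn_mono q l hl (show n + m ≤ n + (m + k) by omega) hx)

lemma En_iext (q : Fin 3 → E2) (hq : ∀ j k : Fin 3, j ≠ k → dist (q j) (q k) = 1)
    (l : ℕ → ℕ) (hl : ∀ n, 5 ≤ l n) (n : ℕ) (g : E2 → ℝ) (m : ℕ) :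
    En q l (n + m) (iext q l n g m) (iext q l n g m) = En q l n g g := by
  induction m with
  | zero => rfl
  | succ m ih =>
    rw [← ih, ← add_assoc]
    simp only [iext]
    rw [En_ext q hq l hl]
    apply En_congr q l hl
    · intros; rfl
    · intro x hx; exact ext_on_Vn q hq l hl _ _ x hx

lemma exists_ext (q : Fin 3 → E2) (hq : ∀ j k : Fin 3, j ≠ k → dist (q j) (q k) = 1)
    (l : ℕ → ℕ) (hl : ∀ n, 5 ≤ l n) (n : ℕ) (g : E2 → ℝ) :
    ∃ u ∈ FDom q l, ∀ x ∈ Vn q l n, u x = g x := by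
  classical
  have hU : ∀ x : E2, ∃ c : ℝ, ∀ m, x ∈ Vn q l (n + m) → iext q l n g m x = c := by
    intro x
    by_cases h : ∃ m, x ∈ Vn q l (n + m)
    · obtain ⟨m0, hm0⟩ := h
      refine ⟨iext q l n g m0 x, fun m hm => ?_⟩
      rcases le_total m m0 with h | h
      · obtain ⟨k, rfl⟩ := Nat.exists_eq_add_of_le h
        exact (iext_stable q hq l hl n g m x hm k).symm
      · obtain ⟨k, rfl⟩ := Nat.exists_eq_add_of_le h
        exact iext_stable q hq l hl n g m0 x hm0 k
    · exact ⟨0, fun m hm => absurd ⟨m, hm⟩ h⟩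
  choose U hU using hU
  refine ⟨U, ⟨En q l n g g, fun k => ?_⟩, fun x hx => ((hU x 0 hx).symm)⟩
  have h1 : En q l (n + k) U U = En q l n g g := by
    rw [← En_iext q hq l hl n g k]
    apply En_congr q l hl <;> exact fun x hx => (hU x k hx).symm
  rw [← h1]
  exact En_mono q l hl U (by omega)

/-! ### Connectivity -/

def LCon (l a b : ℕ) : Prop :=
  ∃ C : ℝ, 0 ≤ C ∧ ∀ V : ℕ → ℕ → ℝ, (V a b - V 0 0) ^ 2 ≤ C * ∑ i ∈ Sf l, cellE V V i.1 i.2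

lemma Con_step {l a b c d : ℕ} (h : LCon l a b)
    (hs : ∀ V : ℕ → ℕ → ℝ, (V c d - V a b) ^ 2 ≤ ∑ i ∈ Sf l, cellE V V i.1 i.2) : LCon l c d := by
  obtain ⟨C, hC, h⟩ := h
  refine ⟨2 * C + 2, by linarith, fun V => ?_⟩
  have h1 := h V
  have h2 := hs V
  nlinarith [sq_nonneg ((V a b - V 0 0) - (V c d - V a b))]

lemma cell_le {l a b : ℕ} (hl : 5 ≤ l) (h : (a, b) ∈ Sset l) (V : ℕ → ℕ → ℝ) :
    (V a b - V (a + 1) b) ^ 2 + (V a b - V a (b + 1)) ^ 2 + (V (a + 1) b - V a (b + 1)) ^ 2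
      ≤ ∑ i ∈ Sf l, cellE V V i.1 i.2 := by
  have h1 : cellE V V (a, b).1 (a, b).2 ≤ ∑ i ∈ Sf l, cellE V V i.1 i.2 := by
    apply Finset.single_le_sum (f := fun i : ℕ × ℕ => cellE V V i.1 i.2) _ ((mem_Sf hl _).2 h)
    intro i _
    exact tri_self_nonneg _ _ _
  refine le_trans (le_of_eq ?_) h1
  simp only [cellE, tri]
  ring

lemma Con_base {l : ℕ} (hl : 5 ≤ l) (a b : ℕ) (h : (a, b) ∈ Sset l) : LCon l a b := by
  have z : LCon l 0 0 := ⟨0, le_rfl, fun V => by simp⟩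
  have bot : ∀ a, a ≤ l - 1 → LCon l a 0 := by
    intro a
    induction a with
    | zero => exact fun _ => z
    | succ a ih =>
      intro ha
      refine Con_step (ih (by omega)) (fun V => ?_)
      have := cell_le hl (a := a) (b := 0) (by rw [mem_Sset_iff]; omega) V
      nlinarith [sq_nonneg (V a 0 - V a (0 + 1)), sq_nonneg (V (a + 1) 0 - V a (0 + 1))]
  have left : ∀ b, b ≤ l - 1 → LCon l 0 b := by
    intro a
    induction a with
    | zero => exact fun _ => z
    | succ a ih =>
      intro ha
      refine Con_step (ih (by omega)) (fun V => ?_)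
      have := cell_le hl (a := 0) (b := a) (by rw [mem_Sset_iff]; omega) V
      nlinarith [sq_nonneg (V 0 a - V (0 + 1) a), sq_nonneg (V (0 + 1) a - V 0 (a + 1))]
  have diag : ∀ a b, a + b = l - 1 → LCon l a b := by
    intro a
    induction a with
    | zero => exact fun b hb => left b (by omega)
    | succ a ih =>
      intro b hb
      have h1 : LCon l (a + 1) (b + 1) := by
        refine Con_step (ih (b + 1) (by omega)) (fun V => ?_)
        have := cell_le hl (a := a) (b := b + 1) (by rw [mem_Sset_iff]; omega) V
        nlinarith [sq_nonneg (V a (b + 1) - V a (b + 1 + 1)),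
          sq_nonneg (V (a + 1) (b + 1) - V a (b + 1 + 1))]
      refine Con_step h1 (fun V => ?_)
      have := cell_le hl (a := a + 1) (b := b) (by rw [mem_Sset_iff]; omega) V
      nlinarith [sq_nonneg (V (a + 1) b - V (a + 1 + 1) b),
        sq_nonneg (V (a + 1 + 1) b - V (a + 1) (b + 1))]
  rw [mem_Sset_iff] at h
  rcases h with ⟨h1, rfl | rfl | h2⟩
  · exact left b (by omega)
  · exact bot a (by omega)
  · exact diag a b h2

lemma osc (q : Fin 3 → E2) (l : ℕ → ℕ) (hl : ∀ n, 5 ≤ l n) (n : ℕ) :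
    ∀ x ∈ Vn q l n, ∃ C : ℝ, 0 ≤ C ∧ ∀ u : E2 → ℝ, (u x - u (q 0)) ^ 2 ≤ C * En q l n u u := by
  induction n with
  | zero =>
    intro x hx
    rw [mem_Vn_iff] at hx
    obtain ⟨w, hw, j, rfl⟩ := hx
    refine ⟨1, zero_le_one, fun u => ?_⟩
    rw [En_eq q l hl]
    simp only [Wf, Rn, Finset.range_zero, Finset.prod_empty, inv_one, one_mul,
      Finset.sum_singleton, wordMap, E0_eq, Function.comp_id, tri, id]
    fin_cases j
    · simp
      nlinarith [mul_self_nonneg (u (q 0) - u (q 1)), mul_self_nonneg (u (q 0) - u (q 2)),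
        mul_self_nonneg (u (q 1) - u (q 2))]
    · simp
      nlinarith [mul_self_nonneg (u (q 0) - u (q 1)), mul_self_nonneg (u (q 0) - u (q 2)),
        mul_self_nonneg (u (q 1) - u (q 2))]
    · simp
      nlinarith [mul_self_nonneg (u (q 0) - u (q 1)), mul_self_nonneg (u (q 0) - u (q 2)),
        mul_self_nonneg (u (q 1) - u (q 2))]
  | succ n ih =>
    intro x hx
    rw [mem_Vn_iff] at hx
    obtain ⟨w, hw, j, rfl⟩ := hx
    rw [← mem_Wf l hl] at hw
    simp only [Wf, Finset.mem_image, Finset.mem_product, Prod.exists] at hw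
    obtain ⟨v, a, b, ⟨hv, hi⟩, rfl⟩ := hw
    rw [mem_Sf (hl n)] at hi
    have hb := Con_base (hl n) a b hi
    have hc1 : LCon (l n) (a + 1) b := by
      refine Con_step hb (fun V => ?_)
      have := cell_le (hl n) hi V
      nlinarith [sq_nonneg (V a b - V a (b + 1)), sq_nonneg (V (a + 1) b - V a (b + 1))]
    have hc2 : LCon (l n) a (b + 1) := by
      refine Con_step hb (fun V => ?_)
      have := cell_le (hl n) hi V
      nlinarith [sq_nonneg (V a b - V (a + 1) b), sq_nonneg (V (a + 1) b - V a (b + 1))]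
    have hx : ∃ c d, LCon (l n) c d ∧ ∀ u : E2 → ℝ,
        u (wordMap q l (Function.update v n (a, b)) (n + 1) (q j)) = lat q l n v u c d := by
      rw [wordMap_update]
      fin_cases j
      · exact ⟨a, b, hb, fun u => by simp [lat, fmap_q0]⟩
      · exact ⟨a + 1, b, hc1, fun u => by simp [lat, fmap_q1]⟩
      · exact ⟨a, b + 1, hc2, fun u => by simp [lat, fmap_q2]⟩
    obtain ⟨c, d, ⟨C, hC, hcd⟩, hx⟩ := hx
    obtain ⟨C', hC', h'⟩ := ih (wordMap q l v n (q 0))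
      (by rw [mem_Vn_iff]; exact ⟨v, (mem_Wf l hl n v).1 hv, 0, rfl⟩)
    refine ⟨2 * (C * (Rn l n * rl (l n))) + 2 * C', ?_, fun u => ?_⟩
    · have := Rn_pos l n
      have := rl_pos (l n)
      positivity
    rw [hx u]
    have k1 := hcd (lat q l n v u)
    have k2 := h' u
    rw [lat_00] at k1
    have k3 : ∑ i ∈ Sf (l n), cellE (lat q l n v u) (lat q l n v u) i.1 i.2
        ≤ (Rn l n * rl (l n)) * En q l (n + 1) u u := by
      rw [En_succ q l hl, mul_assoc, mul_left_comm (rl (l n)), ← mul_assoc (Rn l n),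
        mul_inv_cancel₀ (Rn_pos l n).ne', one_mul, ← Finset.mul_sum, ← mul_assoc,
        mul_inv_cancel₀ (rl_pos _).ne', one_mul]
      apply Finset.single_le_sum (f := fun v =>
        ∑ i ∈ Sf (l n), cellE (lat q l n v u) (lat q l n v u) i.1 i.2) _ hv
      intro v _
      exact sum_cellE_nonneg _ _
    have k4 := mul_le_mul_of_nonneg_left k3 hC
    have k5 := mul_le_mul_of_nonneg_left (En_le_succ q l hl n u) hC'
    nlinarith [sq_nonneg ((lat q l n v u c d - u (wordMap q l v n (q 0))) -
      (u (wordMap q l v n (q 0)) - u (q 0)))]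

/-! ### Algebra of the forms -/

section forms
variable (q : Fin 3 → E2) (l : ℕ → ℕ)

lemma En_symm (hl : ∀ n, 5 ≤ l n) (n : ℕ) (u v : E2 → ℝ) : En q l n u v = En q l n v u := by
  rw [En_eq q l hl, En_eq q l hl]
  congr 1
  apply Finset.sum_congr rfl
  intro w _
  simp only [E0_eq, tri]
  ring

lemma En_lin (hl : ∀ n, 5 ≤ l n) (n : ℕ) (u v w : E2 → ℝ) (a b : ℝ) :
    En q l n (a • u + b • v) w = a * En q l n u w + b * En q l n v w := by
  rw [En_eq q l hl, En_eq q l hl, En_eq q l hl, mul_left_comm a, mul_left_comm b, ← mul_add]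
  congr 1
  rw [Finset.mul_sum, Finset.mul_sum, ← Finset.sum_add_distrib]
  apply Finset.sum_congr rfl
  intro w _
  simp only [E0_eq, tri, Function.comp, Pi.add_apply, Pi.smul_apply, smul_eq_mul]
  ring

lemma En_quad (hl : ∀ n, 5 ≤ l n) (n : ℕ) (u v : E2 → ℝ) (a b : ℝ) :
    En q l n (a • u + b • v) (a • u + b • v) =
      a ^ 2 * En q l n u u + 2 * a * b * En q l n u v + b ^ 2 * En q l n v v := by
  rw [En_lin q l hl, En_symm q l hl n u, En_symm q l hl n v, En_lin q l hl, En_lin q l hl,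
    En_symm q l hl n v u]
  ring

lemma FDom_lin (hl : ∀ n, 5 ≤ l n) {u v : E2 → ℝ} (hu : u ∈ FDom q l) (hv : v ∈ FDom q l)
    (a b : ℝ) : a • u + b • v ∈ FDom q l := by
  obtain ⟨C, hC⟩ := hu
  obtain ⟨D, hD⟩ := hv
  refine ⟨2 * a ^ 2 * C + 2 * b ^ 2 * D, fun n => ?_⟩
  have h1 := En_nonneg q l hl n (a • u + (-b) • v)
  rw [En_quad q l hl] at h1 ⊢
  have h2 := mul_le_mul_of_nonneg_left (hC n) (sq_nonneg a)
  have h3 := mul_le_mul_of_nonneg_left (hD n) (sq_nonneg b)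
  nlinarith

lemma FDom_sub (hl : ∀ n, 5 ≤ l n) {u v : E2 → ℝ} (hu : u ∈ FDom q l) (hv : v ∈ FDom q l) :
    u - v ∈ FDom q l := by
  have := FDom_lin q l hl hu hv 1 (-1)
  rwa [one_smul, neg_smul, one_smul, ← sub_eq_add_neg] at this

lemma tendsto_self (hl : ∀ n, 5 ≤ l n) {u : E2 → ℝ} (hu : u ∈ FDom q l) :
    Tendsto (fun n => En q l n u u) atTop (nhds (EForm q l u u)) := by
  obtain ⟨C, hC⟩ := hu
  have := tendsto_atTop_ciSup (En_mono q l hl u) ⟨C, by rintro _ ⟨n, rfl⟩; exact hC n⟩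
  unfold EForm
  rwa [this.limUnder_eq]

lemma tendsto_EForm (hl : ∀ n, 5 ≤ l n) {u v : E2 → ℝ} (hu : u ∈ FDom q l) (hv : v ∈ FDom q l) :
    Tendsto (fun n => En q l n u v) atTop (nhds (EForm q l u v)) := by
  have h1 := tendsto_self q l hl (FDom_lin q l hl hu hv 1 1)
  have h2 := ((h1.sub (tendsto_self q l hl hu)).sub (tendsto_self q l hl hv)).div_const 2
  have h3 : (fun n => (En q l n ((1 : ℝ) • u + (1 : ℝ) • v) ((1 : ℝ) • u + (1 : ℝ) • v)
      - En q l n u u - En q l n v v) / 2) = fun n => En q l n u v := by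
    funext n
    rw [En_quad q l hl]
    ring
  rw [h3] at h2
  unfold EForm
  rw [h2.limUnder_eq]
  unfold EForm at h2
  exact h2

lemma En_le_EForm (hl : ∀ n, 5 ≤ l n) {u : E2 → ℝ} (hu : u ∈ FDom q l) (n : ℕ) :
    En q l n u u ≤ EForm q l u u :=
  (En_mono q l hl u).ge_of_tendsto (tendsto_self q l hl hu) n

lemma EForm_nonneg (hl : ∀ n, 5 ≤ l n) {u : E2 → ℝ} (hu : u ∈ FDom q l) :
    0 ≤ EForm q l u u :=
  (En_nonneg q l hl 0 u).trans (En_le_EForm q l hl hu 0)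

lemma EForm_le (hl : ∀ n, 5 ≤ l n) {u : E2 → ℝ} {C : ℝ} (hC : ∀ n, En q l n u u ≤ C) :
    EForm q l u u ≤ C :=
  le_of_tendsto' (tendsto_self q l hl ⟨C, hC⟩) hC

lemma osc_EForm (hl : ∀ n, 5 ≤ l n) (x : E2) (hx : x ∈ Vstar q l) :
    ∃ C : ℝ, 0 ≤ C ∧ ∀ u ∈ FDom q l, (u x - u (q 0)) ^ 2 ≤ C * EForm q l u u := by
  simp only [Vstar, Set.mem_iUnion] at hx
  obtain ⟨n, hn⟩ := hx
  obtain ⟨C, hC, h⟩ := osc q l hl n x hn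
  exact ⟨C, hC, fun u hu => (h u).trans
    (mul_le_mul_of_nonneg_left (En_le_EForm q l hl hu n) hC)⟩

lemma En_split (hl : ∀ n, 5 ≤ l n) (n : ℕ) (u p r : E2 → ℝ)
    (h : ∀ x y, (p x - p y) ^ 2 + (r x - r y) ^ 2 ≤ (u x - u y) ^ 2) :
    En q l n p p + En q l n r r ≤ En q l n u u := by
  rw [En_eq q l hl, En_eq q l hl, En_eq q l hl, ← mul_add, ← Finset.sum_add_distrib]
  apply mul_le_mul_of_nonneg_left _ (inv_nonneg.2 (Rn_pos l n).le)
  apply Finset.sum_le_sum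
  intro w _
  simp only [E0_eq, tri, Function.comp]
  have h1 := h (wordMap q l w n (q 0)) (wordMap q l w n (q 1))
  have h2 := h (wordMap q l w n (q 0)) (wordMap q l w n (q 2))
  have h3 := h (wordMap q l w n (q 1)) (wordMap q l w n (q 2))
  nlinarith

lemma En_tendsto (hl : ∀ n, 5 ≤ l n) (n : ℕ) (g : ℕ → E2 → ℝ) (u : E2 → ℝ)
    (h : ∀ x ∈ Vn q l n, ∀ y ∈ Vn q l n,
      Tendsto (fun k => g k x - g k y) atTop (nhds (u x - u y))) :
    Tendsto (fun k => En q l n (g k) (g k)) atTop (nhds (En q l n u u)) := by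
  simp only [En_eq q l hl]
  apply Tendsto.const_mul
  apply tendsto_finsetSum
  intro w hw
  have hm : ∀ j, wordMap q l w n (q j) ∈ Vn q l n := by
    intro j
    rw [mem_Vn_iff]
    exact ⟨w, (mem_Wf l hl n w).1 hw, j, rfl⟩
  simp only [E0, Function.comp]
  apply Tendsto.const_mul
  apply tendsto_finsetSum
  intro i _
  apply tendsto_finsetSum
  intro j _
  exact (h _ (hm i) _ (hm j)).mul (h _ (hm i) _ (hm j))

lemma q0_mem (hl : ∀ n, 5 ≤ l n) : q 0 ∈ Vn q l 0 := by
  rw [mem_Vn_iff]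
  exact ⟨fun _ => (0, 0), (mem_Wf l hl 0 _).1 (by simp [Wf]), 0, rfl⟩

lemma q0_mem' (hl : ∀ n, 5 ≤ l n) : q 0 ∈ Vstar q l :=
  Set.mem_iUnion.2 ⟨0, q0_mem q l hl⟩

lemma const_of_zero (hl : ∀ n, 5 ≤ l n) {u : E2 → ℝ} (hu : u ∈ FDom q l)
    (h0 : EForm q l u u = 0) : ∀ x ∈ Vstar q l, u x = u (q 0) := by
  intro x hx
  obtain ⟨C, _, h⟩ := osc_EForm q l hl x hx
  have := h u hu
  rw [h0, mul_zero] at this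
  have h2 : (u x - u (q 0)) ^ 2 = 0 := le_antisymm this (sq_nonneg _)
  have := pow_eq_zero_iff (two_ne_zero) |>.1 h2
  linarith

lemma RF1 (hl : ∀ n, 5 ≤ l n) : {u : E2 → ℝ | u ∈ FDom q l ∧ EForm q l u u = 0} =
      {u : E2 → ℝ | ∃ c : ℝ, ∀ x ∈ Vstar q l, u x = c} := by
  ext u
  constructor
  · rintro ⟨hu, h0⟩
    exact ⟨u (q 0), const_of_zero q l hl hu h0⟩
  · rintro ⟨c, hc⟩
    have hz : ∀ n, En q l n u u = 0 := by
      intro n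
      have : En q l n u u = En q l n (fun _ => c) (fun _ => c) := by
        apply En_congr q l hl <;> exact fun x hx => hc x (Set.mem_iUnion.2 ⟨n, hx⟩)
      rw [this, En_eq q l hl]
      simp [E0]
    refine ⟨⟨0, fun n => (hz n).le⟩, ?_⟩
    unfold EForm
    simp only [hz]
    exact tendsto_const_nhds.limUnder_eq

lemma RF2 (hl : ∀ n, 5 ≤ l n) (U : ℕ → E2 → ℝ) (hU : ∀ j, U j ∈ FDom q l)
    (hc : ∀ ε : ℝ, 0 < ε → ∃ N, ∀ j ≥ N, ∀ k ≥ N,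
          EForm q l (U j - U k) (U j - U k) < ε) :
    ∃ v ∈ FDom q l, ∀ ε : ℝ, 0 < ε → ∃ N, ∀ j ≥ N,
          EForm q l (U j - v) (U j - v) < ε := by
  have hlim : ∀ x : E2, ∃ c : ℝ, x ∈ Vstar q l →
      Tendsto (fun k => U k x - U k (q 0)) atTop (nhds c) := by
    intro x
    by_cases hx : x ∈ Vstar q l
    · obtain ⟨C, hC, h⟩ := osc_EForm q l hl x hx
      have : CauchySeq (fun k => U k x - U k (q 0)) := by
        rw [Metric.cauchySeq_iff]
        intro ε hε
        obtain ⟨N, hN⟩ := hc (ε ^ 2 / (C + 1)) (by positivity)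
        refine ⟨N, fun j hj k hk => ?_⟩
        have h1 := h _ (FDom_sub q l hl (hU j) (hU k))
        have h2 := hN j hj k hk
        rw [lt_div_iff₀ (by positivity)] at h2
        have h3 := EForm_nonneg q l hl (FDom_sub q l hl (hU j) (hU k))
        simp only [Pi.sub_apply] at h1
        rw [Real.dist_eq]
        apply abs_lt_of_sq_lt_sq _ hε.le
        nlinarith
      obtain ⟨c, hc⟩ := cauchySeq_tendsto_of_complete this
      exact ⟨c, fun _ => hc⟩
    · exact ⟨0, fun h => absurd h hx⟩
  choose v hv using hlim
  have key : ∀ ε : ℝ, 0 < ε → ∃ N, ∀ j ≥ N, ∀ n, En q l n (U j - v) (U j - v) ≤ ε := by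
    intro ε hε
    obtain ⟨N, hN⟩ := hc ε hε
    refine ⟨N, fun j hj n => ?_⟩
    have ht : Tendsto (fun k => En q l n (U j - U k) (U j - U k)) atTop
        (nhds (En q l n (U j - v) (U j - v))) := by
      apply En_tendsto q l hl
      intro x hx y hy
      have hx' := hv x (Set.mem_iUnion.2 ⟨n, hx⟩)
      have hy' := hv y (Set.mem_iUnion.2 ⟨n, hy⟩)
      have := (hx'.sub hy').const_sub (U j x - U j y)
      simp only [Pi.sub_apply]
      convert this using 2 <;> ring
    apply le_of_tendsto ht
    filter_upwards [eventually_ge_atTop N] with k hk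
    exact (En_le_EForm q l hl (FDom_sub q l hl (hU j) (hU k)) n).trans (hN j hj k hk).le
  refine ⟨v, ?_, fun ε hε => ?_⟩
  · obtain ⟨N, hN⟩ := key 1 one_pos
    have h1 : U N - v ∈ FDom q l := ⟨1, hN N le_rfl⟩
    have := FDom_sub q l hl (hU N) h1
    rwa [sub_sub_cancel] at this
  · obtain ⟨N, hN⟩ := key (ε / 2) (by linarith)
    refine ⟨N, fun j hj => ?_⟩
    have := EForm_le q l hl (hN j hj)
    linarith

lemma RF3 (hq : ∀ j k : Fin 3, j ≠ k → dist (q j) (q k) = 1) (hl : ∀ n, 5 ≤ l n)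
    (V : Set E2) (hV : V ⊆ Vstar q l) (hf : V.Finite) (g : E2 → ℝ) :
    ∃ u ∈ FDom q l, Set.EqOn u g V := by
  have : ∃ n, V ⊆ Vn q l n := by
    induction V, hf using Set.Finite.induction_on with
    | empty => exact ⟨0, Set.empty_subset _⟩
    | insert _ _ ih =>
      obtain ⟨n, hn⟩ := ih ((Set.subset_insert _ _).trans hV)
      obtain ⟨m, hm⟩ := Set.mem_iUnion.1 (hV (Set.mem_insert _ _))
      refine ⟨max n m, Set.insert_subset (Vn_mono q l hl (le_max_right _ _) hm)
        (hn.trans (Vn_mono q l hl (le_max_left _ _)))⟩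
  obtain ⟨n, hn⟩ := this
  obtain ⟨u, hu, h⟩ := exists_ext q hq l hl n g
  exact ⟨u, hu, fun x hx => h x (hn hx)⟩

lemma RF4 (hl : ∀ n, 5 ≤ l n) (x : E2) (hx : x ∈ Vstar q l) (y : E2) (hy : y ∈ Vstar q l) :
    BddAbove (REset q l x y) := by
  obtain ⟨C, hC, h⟩ := osc_EForm q l hl x hx
  obtain ⟨D, hD, h'⟩ := osc_EForm q l hl y hy
  refine ⟨2 * C + 2 * D, ?_⟩
  rintro t ⟨u, hu, hpos, rfl⟩
  rw [div_le_iff₀ hpos]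
  have h1 := h u hu
  have h2 := h' u hu
  nlinarith [sq_nonneg ((u x - u (q 0)) + (u y - u (q 0)))]

lemma split_mem (hl : ∀ n, 5 ≤ l n) {u p r : E2 → ℝ} (hu : u ∈ FDom q l)
    (h : ∀ x y, (p x - p y) ^ 2 + (r x - r y) ^ 2 ≤ (u x - u y) ^ 2) :
    p ∈ FDom q l ∧ r ∈ FDom q l ∧ EForm q l p p + EForm q l r r ≤ EForm q l u u := by
  have key := fun n => (En_split q l hl n u p r h).trans (En_le_EForm q l hl hu n)
  have hp : p ∈ FDom q l := ⟨EForm q l u u, fun n => by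
    have := key n; have := En_nonneg q l hl n r; linarith⟩
  have hr : r ∈ FDom q l := ⟨EForm q l u u, fun n => by
    have := key n; have := En_nonneg q l hl n p; linarith⟩
  exact ⟨hp, hr, le_of_tendsto' ((tendsto_self q l hl hp).add (tendsto_self q l hl hr)) key⟩

lemma RF5 (hl : ∀ n, 5 ≤ l n) (u : E2 → ℝ) (hu : u ∈ FDom q l) :
    (fun x => min (max (u x) 0) 1) ∈ FDom q l ∧
      EForm q l (fun x => min (max (u x) 0) 1) (fun x => min (max (u x) 0) 1) ≤
        EForm q l u u := by
  obtain ⟨h1, h2, h3⟩ := split_mem q l hl (p := fun x => min (max (u x) 0) 1) (r := fun _ => 0) hu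
    (by
      intro x y
      simp only [sub_self, ne_eq, OfNat.ofNat_ne_zero, not_false_eq_true, zero_pow, add_zero]
      rw [sq_le_sq]
      exact ((abs_min_sub_min_le_max _ _ _ _).trans (by simp)).trans
        (abs_max_sub_max_le_abs (u x) (u y) 0))
  refine ⟨h1, ?_⟩
  have := EForm_nonneg q l hl h2
  linarith

lemma holder (hl : ∀ n, 5 ≤ l n) (u : E2 → ℝ) (hu : u ∈ FDom q l) (x : E2) (hx : x ∈ Vstar q l)
    (y : E2) (hy : y ∈ Vstar q l) : (u x - u y) ^ 2 ≤ RE q l x y * EForm q l u u := by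
  rcases (EForm_nonneg q l hl hu).eq_or_lt with h | h
  · rw [const_of_zero q l hl hu h.symm x hx, const_of_zero q l hl hu h.symm y hy, ← h]
    simp
  · rw [← div_le_iff₀ h]
    exact le_csSup (RF4 q l hl x hx y hy) ⟨u, hu, h, rfl⟩

lemma RE_nonneg (x y : E2) : 0 ≤ RE q l x y := by
  apply Real.sSup_nonneg
  rintro t ⟨u, hu, hpos, rfl⟩
  positivity

lemma REset_symm (x y : E2) : REset q l x y = REset q l y x := by
  ext t
  constructor
  · rintro ⟨u, hu, h, rfl⟩
    exact ⟨u, hu, h, by ring⟩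
  · rintro ⟨u, hu, h, rfl⟩
    exact ⟨u, hu, h, by ring⟩

lemma RE_zero (hq : ∀ j k : Fin 3, j ≠ k → dist (q j) (q k) = 1) (hl : ∀ n, 5 ≤ l n)
    (x : E2) (hx : x ∈ Vstar q l) (y : E2) (hy : y ∈ Vstar q l) :
    RE q l x y = 0 ↔ x = y := by
  classical
  constructor
  · intro h
    by_contra hne
    obtain ⟨u, hu, he⟩ := RF3 q l hq hl {x, y} (by
      intro z hz
      rcases hz with rfl | hz
      · exact hx
      · rw [Set.mem_singleton_iff] at hz; subst hz; exact hy) (by simp)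
      (fun z => if z = x then 1 else 0)
    have := holder q l hl u hu x hx y hy
    rw [he (by simp), he (by simp), h] at this
    simp [Ne.symm hne] at this
    linarith
  · rintro rfl
    apply le_antisymm _ (RE_nonneg q l x x)
    apply Real.sSup_le _ le_rfl
    rintro t ⟨u, hu, hpos, rfl⟩
    simp

lemma RE_triangle_aux (hl : ∀ n, 5 ≤ l n) (x : E2) (hx : x ∈ Vstar q l) (y : E2)
    (hy : y ∈ Vstar q l) (z : E2) (hz : z ∈ Vstar q l) (u : E2 → ℝ) (hu : u ∈ FDom q l)
    (hle : u z ≤ u x) :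
    (u x - u z) ^ 2 ≤ (RE q l x y + RE q l y z) * EForm q l u u := by
  have hxy := holder q l hl u hu x hx y hy
  have hyz := holder q l hl u hu y hy z hz
  have p1 := mul_nonneg (RE_nonneg q l x y) (EForm_nonneg q l hl hu)
  have p2 := mul_nonneg (RE_nonneg q l y z) (EForm_nonneg q l hl hu)
  rcases le_total (u x) (u y) with h1 | h1
  · nlinarith
  rcases le_total (u y) (u z) with h2 | h2
  · nlinarith
  obtain ⟨m1, m2, hE⟩ := split_mem q l hl (p := fun t => max (u t) (u y))
    (r := fun t => min (u t) (u y)) hu (by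
      intro s t
      rcases le_total (u s) (u y) with a | a <;> rcases le_total (u t) (u y) with b | b
      · rw [max_eq_right a, max_eq_right b, min_eq_left a, min_eq_left b]; nlinarith
      · rw [max_eq_right a, max_eq_left b, min_eq_left a, min_eq_right b]; nlinarith
      · rw [max_eq_left a, max_eq_right b, min_eq_right a, min_eq_left b]; nlinarith
      · rw [max_eq_left a, max_eq_left b, min_eq_right a, min_eq_right b]; nlinarith)
  have k1 := holder q l hl _ m1 x hx y hy
  have k2 := holder q l hl _ m2 y hy z hz
  simp only [max_eq_left h1, max_self] at k1
  simp only [min_eq_left h2, min_self] at k2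
  have n1 := EForm_nonneg q l hl m1
  have n2 := EForm_nonneg q l hl m2
  set E1 := EForm q l (fun t => max (u t) (u y)) (fun t => max (u t) (u y))
  set E2' := EForm q l (fun t => min (u t) (u y)) (fun t => min (u t) (u y))
  have r1 := RE_nonneg q l x y
  have r2 := RE_nonneg q l y z
  set R1 := RE q l x y
  set R2 := RE q l y z
  have hA : 0 ≤ u x - u y := by linarith
  have hB : 0 ≤ u y - u z := by linarith
  have hprod : (u x - u y) * (u y - u z) * 2 ≤ R1 * E2' + R2 * E1 := by
    have e1 : ((u x - u y) * (u y - u z)) ^ 2 ≤ (R1 * E2') * (R2 * E1) := by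
      calc ((u x - u y) * (u y - u z)) ^ 2 = (u x - u y) ^ 2 * (u y - u z) ^ 2 := by ring
        _ ≤ (R1 * E1) * (R2 * E2') := by
          apply mul_le_mul k1 k2 (sq_nonneg _) (mul_nonneg r1 n1)
        _ = _ := by ring
    have e2 : 0 ≤ R1 * E2' + R2 * E1 := by positivity
    apply le_of_sq_le_sq _ e2
    nlinarith [sq_nonneg (R1 * E2' - R2 * E1)]
  have hfin : (u x - u z) ^ 2 ≤ (R1 + R2) * (E1 + E2') := by nlinarith
  exact hfin.trans (mul_le_mul_of_nonneg_left hE (by positivity))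

lemma RE_triangle (hl : ∀ n, 5 ≤ l n) (x : E2) (hx : x ∈ Vstar q l) (y : E2)
    (hy : y ∈ Vstar q l) (z : E2) (hz : z ∈ Vstar q l) :
    RE q l x z ≤ RE q l x y + RE q l y z := by
  apply Real.sSup_le _ (add_nonneg (RE_nonneg q l x y) (RE_nonneg q l y z))
  rintro t ⟨u, hu, hpos, rfl⟩
  rw [div_le_iff₀ hpos]
  rcases le_total (u z) (u x) with h | h
  · exact RE_triangle_aux q l hl x hx y hy z hz u hu h
  · have := RE_triangle_aux q l hl z hz y hy x hx u hu h
    have s1 : RE q l z y = RE q l y z := by unfold RE; rw [REset_symm]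
    have s2 : RE q l y x = RE q l x y := by unfold RE; rw [REset_symm]
    rw [s1, s2] at this
    nlinarith

end forms

/-- `(E,F)` is a resistance form on `V_*`, `R_E` is a metric on `V_*`,
and `|u(x)−u(y)|² ≤ R_E(x,y)·E(u,u)`. -/
theorem stmt4 (q : Fin 3 → E2) (hq : ∀ j k : Fin 3, j ≠ k → dist (q j) (q k) = 1)
    (l : ℕ → ℕ) (hl : ∀ n, 5 ≤ l n) :
    -- (RF1) null space of E is exactly the constants on V_*
    ({u : E2 → ℝ | u ∈ FDom q l ∧ EForm q l u u = 0} =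
      {u : E2 → ℝ | ∃ c : ℝ, ∀ x ∈ Vstar q l, u x = c}) ∧
    -- (RF2) (F/constants, E) is a Hilbert space: E is a nonnegative symmetric
    -- bilinear form on F and the associated seminormed space is complete
    ((∀ u ∈ FDom q l, 0 ≤ EForm q l u u) ∧
     (∀ u ∈ FDom q l, ∀ v ∈ FDom q l, EForm q l u v = EForm q l v u) ∧
     (∀ u ∈ FDom q l, ∀ v ∈ FDom q l, ∀ w ∈ FDom q l, ∀ a b : ℝ,
        EForm q l (a • u + b • v) w = a * EForm q l u w + b * EForm q l v w) ∧
     (∀ U : ℕ → E2 → ℝ, (∀ j, U j ∈ FDom q l) →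
        (∀ ε : ℝ, 0 < ε → ∃ N, ∀ j ≥ N, ∀ k ≥ N,
          EForm q l (U j - U k) (U j - U k) < ε) →
        ∃ v ∈ FDom q l, ∀ ε : ℝ, 0 < ε → ∃ N, ∀ j ≥ N,
          EForm q l (U j - v) (U j - v) < ε)) ∧
    -- (RF3) every function on a nonempty finite subset of V_* extends to F
    (∀ V : Set E2, V ⊆ Vstar q l → V.Finite → V.Nonempty →
      ∀ g : E2 → ℝ, ∃ u ∈ FDom q l, Set.EqOn u g V) ∧
    -- (RF4) R_E(x,y) < ∞
    (∀ x ∈ Vstar q l, ∀ y ∈ Vstar q l, BddAbove (REset q l x y)) ∧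
    -- (RF5) the unit contraction operates on (E,F)
    (∀ u ∈ FDom q l, (fun x => min (max (u x) 0) 1) ∈ FDom q l ∧
      EForm q l (fun x => min (max (u x) 0) 1) (fun x => min (max (u x) 0) 1) ≤
        EForm q l u u) ∧
    -- R_E is a metric on V_*
    ((∀ x ∈ Vstar q l, ∀ y ∈ Vstar q l, (RE q l x y = 0 ↔ x = y)) ∧
     (∀ x ∈ Vstar q l, ∀ y ∈ Vstar q l, RE q l x y = RE q l y x) ∧
     (∀ x ∈ Vstar q l, ∀ y ∈ Vstar q l, ∀ z ∈ Vstar q l,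
        RE q l x z ≤ RE q l x y + RE q l y z)) ∧
    -- Hoelder bound
    (∀ u ∈ FDom q l, ∀ x ∈ Vstar q l, ∀ y ∈ Vstar q l,
      (u x - u y) ^ 2 ≤ RE q l x y * EForm q l u u) := by
  refine ⟨RF1 q l hl, ⟨fun u hu => EForm_nonneg q l hl hu, ?_, ?_, RF2 q l hl⟩,
    fun V hV hf _ g => RF3 q l hq hl V hV hf g, RF4 q l hl, RF5 q l hl,
    ⟨RE_zero q l hq hl, ?_, RE_triangle q l hl⟩, holder q l hl⟩
  · intro u _ v _
    unfold EForm
    simp only [En_symm q l hl _ u v]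
  · intro u hu v hv w hw a b
    have h1 := tendsto_EForm q l hl (FDom_lin q l hl hu hv a b) hw
    have h2 := ((tendsto_EForm q l hl hu hw).const_mul a).add
      ((tendsto_EForm q l hl hv hw).const_mul b)
    simp only [En_lin q l hl] at h1
    exact tendsto_nhds_unique h1 h2
  · intro x _ y _
    unfold RE
    rw [REset_symm]
end
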